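/- arXiv:2004.06964 — 9 statements merged into one kernel-verified Lean document; each statement's English description precedes it below -/
import Mathlib

section
/- For every cactus G — a finite connected simple graph in which any two distinct cycles share at most one vertex (equivalently, every edge of G lies on at most one cycle) — the semi-proper orientation number satisfies χ⃗_s(G) ≤ 3; that is, G admits a semi-proper orientation (D,w) with w⁻(v) ≤ 3 for every vertex v. -/
open Finset

/-- `w u v` is the weight of the arc `u → v` of the orientation (and `0` if there is no
such arc).  The in-weight of `v` is the sum of the weights of the arcs with head `v`. -/
def inWeight {V : Type*} [Fintype V] (w : V → V → ℕ) (v : V) : ℕ := ∑ u, w u v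

/-- `w` encodes a semi-proper orientation `(D, w)` of `G`: every edge `{u,v}` of `G` is
oriented in exactly one direction, carrying a positive integer weight (non-arcs get
weight `0`), and adjacent vertices have distinct in-weights. -/
def IsSemiProperOrientation {V : Type*} [Fintype V] (G : SimpleGraph V) (w : V → V → ℕ) :
    Prop :=
  (∀ u v, G.Adj u v → (0 < w u v ∧ w v u = 0) ∨ (0 < w v u ∧ w u v = 0)) ∧
  (∀ u v, ¬ G.Adj u v → w u v = 0) ∧
  (∀ u v, G.Adj u v → inWeight w u ≠ inWeight w v)

/-- The semi-proper orientation number `χ⃗ₛ(G)`: the least `k` such that `G` has a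
semi-proper orientation with all in-weights at most `k`. -/
noncomputable def spoNumber {V : Type*} [Fintype V] (G : SimpleGraph V) : ℕ :=
  sInf { k | ∃ w, IsSemiProperOrientation G w ∧ ∀ v, inWeight w v ≤ k }


/-- Two vertices `x`, `q` adjacent to `v` and connected by a walk avoiding `v` give a cycle through
`v` whose only edges at `v` are `vx` and `vq`. -/
lemma exists_cycle_of_avoiding {V : Type*} [DecidableEq V] (G : SimpleGraph V) {v x q : V}
    (hx : G.Adj v x) (hq : G.Adj q v) (hne : x ≠ q) (W : G.Walk x q) (hW : v ∉ W.support) :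
    ∃ c : G.Walk v v, c.IsCycle ∧ q ∈ c.support ∧ s(v, x) ∈ c.edges ∧
      ∀ y, s(v, y) ∈ c.edges → y = x ∨ y = q := by
  have hP : W.bypass.IsPath := W.bypass_isPath
  have hv : v ∉ W.bypass.support := fun h => hW (W.support_bypass_subset_support h)
  have hvx : v ≠ x := hx.ne
  have hpath : (W.bypass.concat hq).IsPath := hP.concat hv hq
  refine ⟨SimpleGraph.Walk.cons hx (W.bypass.concat hq), ?_, ?_, ?_, ?_⟩
  · rw [SimpleGraph.Walk.cons_isCycle_iff]
    refine ⟨hpath, ?_⟩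
    rw [SimpleGraph.Walk.edges_concat]
    intro h
    simp only [List.concat_eq_append, List.mem_append, List.mem_singleton] at h
    rcases h with h | h
    · exact hv (SimpleGraph.Walk.fst_mem_support_of_mem_edges _ h)
    · rw [Sym2.eq_iff] at h
      rcases h with ⟨h1, h2⟩ | ⟨h1, h2⟩
      · exact hvx h2.symm
      · exact hne h2
  · simp [SimpleGraph.Walk.support_concat]
  · simp
  · intro y hy
    rw [SimpleGraph.Walk.edges_cons, SimpleGraph.Walk.edges_concat] at hy
    simp only [List.concat_eq_append, List.mem_append, List.mem_singleton, List.mem_cons] at hy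
    rcases hy with h | h | h
    · rw [Sym2.eq_iff] at h
      grind
    · exact absurd (SimpleGraph.Walk.fst_mem_support_of_mem_edges _ h) hv
    · rw [Sym2.eq_iff] at h
      grind

theorem cactus_semiProperOrientationNumber_le_three
    {V : Type*} [Fintype V] [DecidableEq V] (G : SimpleGraph V)
    (hconn : G.Connected)
    (hcactus : ∀ (u v : V) (c : G.Walk u u) (d : G.Walk v v), c.IsCycle → d.IsCycle →
      c.edges.toFinset ≠ d.edges.toFinset →
      ∀ x y : V, x ∈ c.support → x ∈ d.support → y ∈ c.support → y ∈ d.support → x = y) :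
    spoNumber G ≤ 3 ∧
      ∃ w, IsSemiProperOrientation G w ∧ ∀ v, inWeight w v ≤ 3 := by
  classical
  suffices h : ∃ w, IsSemiProperOrientation G w ∧ ∀ v, inWeight w v ≤ 3 from
    ⟨Nat.sInf_le h, h⟩
  obtain ⟨r⟩ := hconn.nonempty
  -- breadth-first levels and parents
  obtain ⟨δ, hδ⟩ : ∃ δ : V → ℕ, ∀ v, δ v = G.dist v r := ⟨_, fun _ => rfl⟩
  have hδ0 : ∀ v, δ v = 0 → v = r := by
    intro v h
    rw [hδ] at h
    exact (hconn.dist_eq_zero_iff).1 h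
  have hδr : δ r = 0 := by rw [hδ]; simp
  have hδadj : ∀ u v, G.Adj u v → δ u ≤ δ v + 1 := by
    intro u v h
    have := hconn.dist_triangle (u := u) (v := v) (w := r)
    rw [SimpleGraph.dist_eq_one_iff_adj.2 h] at this
    rw [hδ, hδ]; omega
  have hpar : ∀ v, ∃ q, v ≠ r → G.Adj q v ∧ δ q + 1 = δ v := by
    intro v
    by_cases hv : v = r
    · exact ⟨v, fun h => absurd hv h⟩
    obtain ⟨W, hW⟩ := hconn.exists_walk_length_eq_dist v r
    cases W with
    | nil => exact absurd rfl hv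
    | @cons _ q _ h W' =>
      refine ⟨q, fun _ => ⟨h.symm, ?_⟩⟩
      have h1 := SimpleGraph.dist_le W'
      have h2 := hδadj _ _ h
      rw [SimpleGraph.Walk.length_cons] at hW
      rw [hδ, hδ] at *
      omega
  choose p hp using hpar
  -- walks to the root avoiding `v`
  have hwalk : ∀ v, v ≠ r → ∀ n a, δ a = n → n ≤ δ v → a ≠ v →
      ∃ W : G.Walk a r, v ∉ W.support := by
    intro v hv n
    induction n with
    | zero =>
      intro a ha _ hav
      obtain rfl := hδ0 a ha
      exact ⟨SimpleGraph.Walk.nil, by simpa using hv⟩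
    | succ n ih =>
      intro a ha hn hav
      have har : a ≠ r := by rintro rfl; omega
      obtain ⟨h1, h2⟩ := hp a har
      obtain ⟨W, hW⟩ := ih (p a) (by omega) (by omega) (by rintro h; rw [h] at h2; omega)
      exact ⟨SimpleGraph.Walk.cons h1.symm W, by simp [hW, hav.symm]⟩
  -- non-tree edges
  obtain ⟨M, hM⟩ : ∃ M : V → V → Prop, ∀ u v, M u v ↔
      G.Adj u v ∧ (u ≠ r → p u ≠ v) ∧ (v ≠ r → p v ≠ u) := ⟨_, fun _ _ => Iff.rfl⟩
  have hMsymm : ∀ u v, M u v → M v u := by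
    intro u v h
    rw [hM] at *
    exact ⟨h.1.symm, h.2.2, h.2.1⟩
  have hMr : ∀ u v, M u v → u ≠ r := by
    rintro u v h rfl
    rw [hM] at h
    obtain ⟨h1, _, h3⟩ := h
    have hv : v ≠ u := h1.ne'
    have := hp v hv
    have h4 := hδadj _ _ h1.symm
    exact h3 hv (hδ0 _ (by omega))
  have hMcycle : ∀ v x, M v x → ∃ c : G.Walk v v, c.IsCycle ∧ p v ∈ c.support ∧
      s(v, x) ∈ c.edges ∧ ∀ y, s(v, y) ∈ c.edges → y = x ∨ y = p v := by
    intro v x hvx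
    have hv := hMr _ _ hvx
    have hx := hMr _ _ (hMsymm _ _ hvx)
    rw [hM] at hvx
    obtain ⟨h1, h2, h3⟩ := hvx
    obtain ⟨hpv, hpv'⟩ := hp v hv
    obtain ⟨hpx, hpx'⟩ := hp x hx
    have h4 := hδadj _ _ h1.symm
    obtain ⟨W1, hW1⟩ : ∃ W : G.Walk x r, v ∉ W.support := by
      obtain ⟨W, hW⟩ := hwalk v hv _ (p x) rfl (by omega) (h3 hx)
      exact ⟨SimpleGraph.Walk.cons hpx.symm W, by simp [hW, h1.ne]⟩
    obtain ⟨W2, hW2⟩ := hwalk v hv _ (p v) rfl (by omega) hpv.ne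
    refine exists_cycle_of_avoiding G h1 hpv (h2 hv).symm (W1.append W2.reverse) ?_
    simp [SimpleGraph.Walk.mem_support_append_iff, hW1, hW2]
  have hMuniq : ∀ v x y, M v x → M v y → x = y := by
    intro v x y hx hy
    by_contra hxy
    obtain ⟨c, hc, hpc, hcx, hc'⟩ := hMcycle v x hx
    obtain ⟨d, hd, hpd, hdy, hd'⟩ := hMcycle v y hy
    have hv := hMr _ _ hx
    refine (hp v hv).1.ne (hcactus v v c d hc hd ?_ _ _ hpc hpd c.start_mem_support
      d.start_mem_support)
    intro h
    have : s(v, x) ∈ d.edges := by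
      rw [← List.mem_toFinset, ← h, List.mem_toFinset]; exact hcx
    rcases hd' x this with h | h
    · exact hxy h
    · exact ((hM _ _).1 hx).2.1 hv h.symm
  have hm : ∀ v, ∃ z, ∀ y, M v y → y = z := by
    intro v
    by_cases h : ∃ y, M v y
    · obtain ⟨z, hz⟩ := h
      exact ⟨z, fun y hy => hMuniq v y z hy hz⟩
    · exact ⟨v, fun y hy => absurd ⟨y, hy⟩ h⟩
  choose m hm using hm
  -- greedy 3-colouring
  have hcol : ∀ S : Finset V, ∃ f : V → ℕ, (∀ v, 1 ≤ f v ∧ f v ≤ 3) ∧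
      ∀ u ∈ S, ∀ v ∈ S, G.Adj u v → f u ≠ f v := by
    intro S
    induction S using Finset.induction_on_max_value δ with
    | empty => exact ⟨fun _ => 1, by simp, by simp⟩
    | insert a s has hmax ih =>
      obtain ⟨f, hf, hfs⟩ := ih
      have hnb : ∀ u ∈ s, G.Adj a u → u = p a ∨ u = m a := by
        intro u hu hau
        by_cases hM' : M a u
        · exact Or.inr (hm _ _ hM')
        left
        rw [hM] at hM'
        have hle := hmax u hu
        by_contra hne
        refine hM' ⟨hau, fun _ h => hne h.symm, fun hur h => ?_⟩
        have := (hp u hur).2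
        rw [h] at this
        omega
      obtain ⟨k, hk1, hk3, hkp, hkm⟩ : ∃ k, 1 ≤ k ∧ k ≤ 3 ∧ k ≠ f (p a) ∧ k ≠ f (m a) := by
        by_cases h1 : 1 ≠ f (p a) ∧ 1 ≠ f (m a)
        · exact ⟨1, by omega, by omega, h1⟩
        by_cases h2 : 2 ≠ f (p a) ∧ 2 ≠ f (m a)
        · exact ⟨2, by omega, by omega, h2⟩
        exact ⟨3, by omega, by omega, by omega, by omega⟩
      have hka : ∀ u ∈ s, G.Adj a u → k ≠ f u := by
        intro u hu hau
        rcases hnb u hu hau with h | h <;> rw [h] <;> assumption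
      refine ⟨Function.update f a k, ?_, ?_⟩
      · intro v
        by_cases h : v = a
        · subst h; simp [hk1, hk3]
        · simpa [h] using hf v
      · intro u hu v hv huv
        rw [Finset.mem_insert] at hu hv
        by_cases hua : u = a
        · subst hua
          have hvu : v ≠ u := huv.ne'
          simpa [hvu] using hka v (hv.resolve_left hvu) huv
        · by_cases hva : v = a
          · subst hva
            simpa [hua] using (hka u (hu.resolve_left hua) huv.symm).symm
          · simpa [hua, hva] using hfs u (hu.resolve_left hua) v (hv.resolve_left hva) huv
  obtain ⟨f, hf, hfadj⟩ := hcol Finset.univ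
  replace hfadj : ∀ u v, G.Adj u v → f u ≠ f v := fun u v h =>
    hfadj u (Finset.mem_univ _) v (Finset.mem_univ _) h
  -- the weights
  obtain ⟨e, he⟩ : ∃ e : V → ℕ, ∀ v, e v = if M v (m v) ∧ f (m v) < f v then 1 else 0 :=
    ⟨_, fun _ => rfl⟩
  have he0 : ∀ v, e v ≠ 0 → M v (m v) := by
    intro v h
    rw [he] at h
    by_contra h'
    simp [h'] at h
  have hef : ∀ v, e v < f v := by
    intro v
    rw [he]
    split_ifs with h
    · have := (hf (m v)).1
      omega
    · have := (hf v).1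
      omega
  obtain ⟨w, hw⟩ : ∃ w : V → V → ℕ, ∀ u v, w u v = if v = r then 0 else
      (if u = p v then f v - e v else 0) + (if u = m v then e v else 0) := ⟨_, fun _ _ => rfl⟩
  have hin : ∀ v, inWeight w v = if v = r then 0 else f v := by
    intro v
    unfold inWeight
    simp only [hw]
    split_ifs with h
    · simp
    · rw [Finset.sum_add_distrib]
      have := hef v
      simp
      omega
  have htree : ∀ u v, v ≠ r → p v = u → 0 < w u v ∧ w v u = 0 := by
    intro u v hv hpv
    have h1 := hef v
    obtain ⟨h2, h3⟩ := hp v hv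
    constructor
    · rw [hw, if_neg hv, if_pos hpv.symm]
      omega
    · rw [hw]
      by_cases hu : u = r
      · simp [hu]
      rw [if_neg hu]
      have h4 := (hp u hu).2
      have h5 : v ≠ p u := by
        rintro h
        rw [← h] at h4
        rw [hpv] at h3
        omega
      rw [if_neg h5]
      split_ifs with h6
      · by_contra h7
        have h8 := he0 u (by omega)
        rw [← h6, hM] at h8
        exact h8.2.2 hv hpv
      · rfl
  have hnon : ∀ u v, M u v → f u < f v → 0 < w u v ∧ w v u = 0 := by
    intro u v huv hlt
    have hvu := hMsymm _ _ huv
    have hu := hMr _ _ huv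
    have hv := hMr _ _ hvu
    have h1 := hm _ _ huv
    have h2 := hm _ _ hvu
    have h3 := (hM _ _).1 huv
    have hev : e v = 1 := by
      rw [he, if_pos]; rw [← h2]; exact ⟨hvu, hlt⟩
    have heu : e u = 0 := by
      rw [he, if_neg]; rw [← h1]; rintro ⟨_, h⟩; omega
    constructor
    · rw [hw, if_neg hv, if_pos h2]
      omega
    · rw [hw, if_neg hu, if_neg (h3.2.1 hu).symm, heu]
      simp
  refine ⟨w, ⟨?_, ?_, ?_⟩, ?_⟩
  · intro u v huv
    by_cases hMuv : M u v
    · rcases lt_or_gt_of_ne (hfadj u v huv) with h | h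
      · exact Or.inl (hnon u v hMuv h)
      · exact Or.inr (hnon v u (hMsymm _ _ hMuv) h)
    · rw [hM] at hMuv
      by_cases h1 : v ≠ r ∧ p v = u
      · exact Or.inl (htree u v h1.1 h1.2)
      · by_cases h2 : u ≠ r ∧ p u = v
        · exact Or.inr (htree v u h2.1 h2.2)
        · exact absurd ⟨huv, fun h h' => h2 ⟨h, h'⟩, fun h h' => h1 ⟨h, h'⟩⟩ hMuv
  · intro u v huv
    rw [hw]
    by_cases hv : v = r
    · simp [hv]
    have h1 : u ≠ p v := by
      rintro rfl
      exact huv (hp v hv).1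
    rw [if_neg hv, if_neg h1]
    split_ifs with h2
    · by_contra h3
      have h4 := he0 v (by omega)
      rw [← h2, hM] at h4
      exact huv h4.1.symm
    · rfl
  · intro u v huv
    rw [hin, hin]
    have h1 := (hf u).1
    have h2 := (hf v).1
    have h3 := hfadj u v huv
    have h4 := huv.ne
    split_ifs with h5 h6 h6
    · exact absurd (h5.trans h6.symm) h4
    · omega
    · omega
    · exact h3
  · intro v
    rw [hin]
    have := (hf v).2
    split_ifs <;> omega
end

section
/- Let G be the simple graph with vertex set {v1,v2,v3,v4,v5,v6} and edge set {v1v2, v1v3, v2v3, v3v4, v4v5, v4v6, v5v6} (two triangles joined by the edge v3v4). Then G has no semi-proper orientation (D,w) with w⁻(v) ≤ 2 for every vertex v, and in fact χ⃗_s(G) = 3. -/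
open Finset

/-- Explicit orientation with maximum in-weight 3. -/
def witnessWeight : Fin 6 → Fin 6 → ℕ :=
  ![![0,1,0,0,0,0], ![0,0,0,0,0,0], ![1,1,0,1,0,0], ![0,0,0,0,2,1], ![0,0,0,0,0,2],
    ![0,0,0,0,0,0]]

theorem adj_list (u v : Fin 6) : (SimpleGraph.fromEdgeSet
      {s(0, 1), s(0, 2), s(1, 2), s(2, 3), s(3, 4), s(3, 5), s(4, 5)}).Adj u v ↔
    (s(u, v) ∈ ([s(0, 1), s(0, 2), s(1, 2), s(2, 3), s(3, 4), s(3, 5), s(4, 5)] :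
      List (Sym2 (Fin 6)))) := by
  rw [SimpleGraph.fromEdgeSet_adj]
  simp only [Set.mem_insert_iff, Set.mem_singleton_iff, List.mem_cons, List.not_mem_nil, or_false]
  revert u v
  decide

/-- the cactus consisting of two triangles `v1v2v3`, `v4v5v6` joined by the
edge `v3v4` (vertices renamed `0,…,5`) has no semi-proper orientation with all in-weights
at most `2`, and its semi-proper orientation number equals `3`. -/
theorem twoTriangles_semiProperOrientationNumber_eq_three
    (G : SimpleGraph (Fin 6))
    (hG : G = SimpleGraph.fromEdgeSet
      {s(0, 1), s(0, 2), s(1, 2), s(2, 3), s(3, 4), s(3, 5), s(4, 5)}) :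
    (¬ ∃ w, IsSemiProperOrientation G w ∧ ∀ v, inWeight w v ≤ 2) ∧
      spoNumber G = 3 := by
  have key : ¬ ∃ w, IsSemiProperOrientation G w ∧ ∀ v, inWeight w v ≤ 2 := by
    rintro ⟨w, ⟨h1, -, h3⟩, h⟩
    subst hG
    simp only [adj_list] at h1 h3
    have a1 := h1 0 1 (by decide)
    have a2 := h1 0 2 (by decide)
    have a3 := h1 1 2 (by decide)
    have a4 := h1 2 3 (by decide)
    have a5 := h1 3 4 (by decide)
    have a6 := h1 3 5 (by decide)
    have a7 := h1 4 5 (by decide)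
    have b1 := h3 0 1 (by decide)
    have b2 := h3 0 2 (by decide)
    have b3 := h3 1 2 (by decide)
    have b5 := h3 3 4 (by decide)
    have b6 := h3 3 5 (by decide)
    have b7 := h3 4 5 (by decide)
    have c0 := h 0
    have c1 := h 1
    have c2 := h 2
    have c3 := h 3
    have c4 := h 4
    have c5 := h 5
    have s1 : inWeight w 0 + inWeight w 1 + inWeight w 2 ≤ 3 := by clear * - b1 b2 b3 c0 c1 c2; omega
    have s2 : inWeight w 3 + inWeight w 4 + inWeight w 5 ≤ 3 := by clear * - b5 b6 b7 c3 c4 c5; omega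
    have e1 : 1 ≤ w 0 1 + w 1 0 := by clear * - a1; omega
    have e2 : 1 ≤ w 0 2 + w 2 0 := by clear * - a2; omega
    have e3 : 1 ≤ w 1 2 + w 2 1 := by clear * - a3; omega
    have e4 : 1 ≤ w 2 3 + w 3 2 := by clear * - a4; omega
    have e5 : 1 ≤ w 3 4 + w 4 3 := by clear * - a5; omega
    have e6 : 1 ≤ w 3 5 + w 5 3 := by clear * - a6; omega
    have e7 : 1 ≤ w 4 5 + w 5 4 := by clear * - a7; omega
    clear h h1 h3 a1 a2 a3 a4 a5 a6 a7 b1 b2 b3 b5 b6 b7 c0 c1 c2 c3 c4 c5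
    simp only [inWeight, Fin.sum_univ_six] at s1 s2
    omega
  refine ⟨key, ?_⟩
  have mem : ∃ w, IsSemiProperOrientation G w ∧ ∀ v, inWeight w v ≤ 3 := by
    refine ⟨witnessWeight, ?_, by unfold inWeight; decide⟩
    subst hG
    unfold IsSemiProperOrientation inWeight
    simp only [adj_list]
    refine ⟨by decide, by decide, by decide⟩
  unfold spoNumber
  apply le_antisymm
  · exact Nat.sInf_le mem
  · refine le_csInf ⟨3, mem⟩ ?_
    rintro k ⟨w, hw, hk⟩
    by_contra hlt
    exact key ⟨w, hw, fun v => (hk v).trans (by omega)⟩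
end

section
/- Every finite simple graph G has an optimal semi-proper orientation in which the weight of every arc is one or two; that is, there exists a semi-proper orientation (D,w) of G with max_{v∈V(G)} w⁻(v) = χ⃗_s(G) and w(a) ∈ {1,2} for every arc a of D. -/
open Finset

/-- Orientation given by in-neighbourhoods `I`, with target in-weights `f`. -/
structure ValidPair {V : Type*} (G : SimpleGraph V) (k : ℕ)
    (I : V → Finset V) (f : V → ℕ) : Prop where
  or_adj : ∀ u v, G.Adj u v → (u ∈ I v ↔ v ∉ I u)
  adj : ∀ u v, u ∈ I v → G.Adj u v
  proper : ∀ u v, G.Adj u v → f u ≠ f v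
  le : ∀ v, #(I v) ≤ f v
  zero : ∀ v, #(I v) = 0 → f v = 0
  bd : ∀ v, f v ≤ k

/-- The potential. -/
def potential {V : Type*} [Fintype V] (I : V → Finset V) (f : V → ℕ) : ℕ :=
  ∑ v, f v * (Fintype.card V + 1 - #(I v))

lemma ValidPair.improve {V : Type*} [Fintype V] {G : SimpleGraph V} {k : ℕ}
    {I : V → Finset V} {f : V → ℕ} (h : ValidPair G k I f) (v : V) (hv : 2 * #(I v) < f v) :
    ∃ Inew fnew, ValidPair G k Inew fnew ∧ potential Inew fnew < potential I f := by
  classical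
  have hd : 1 ≤ #(I v) := by
    by_contra hc
    have := h.zero v (by omega)
    omega
  have hcard : ∀ x, #(I x) ≤ Fintype.card V := fun x => Finset.card_le_univ _
  by_cases hj : ∃ j, #(I v) ≤ j ∧ j ≤ 2 * #(I v) ∧ ∀ u, G.Adj u v → f u ≠ j
  · obtain ⟨j, h1, h2, h3⟩ := hj
    refine ⟨I, fun x => if x = v then j else f x, ⟨h.or_adj, h.adj, ?_, ?_, ?_, ?_⟩, ?_⟩
    · intro a b hab
      have := h.proper a b hab
      have := h3 a
      have := h3 b
      have := hab.symm
      have := hab.ne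
      grind
    · intro x
      have := h.le x
      grind
    · intro x hx
      have := h.zero x hx
      grind
    · intro x
      have := h.bd x
      have := h.bd v
      grind
    · unfold potential
      apply Finset.sum_lt_sum
      · intro x _
        apply Nat.mul_le_mul_right
        grind
      · refine ⟨v, mem_univ _, ?_⟩
        apply Nat.mul_lt_mul_of_pos_right
        · simp; omega
        · have := hcard v; omega
  · push Not at hj
    have hu : ∃ u, G.Adj u v ∧ u ∉ I v ∧ f u ≤ 2 * #(I v) := by
      by_contra hc
      push Not at hc
      have hsub : Finset.Icc (#(I v)) (2 * #(I v)) ⊆ (I v).image f := by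
        intro j hjm
        rw [Finset.mem_Icc] at hjm
        obtain ⟨u, hua, huf⟩ := hj j hjm.1 hjm.2
        rw [Finset.mem_image]
        refine ⟨u, ?_, huf⟩
        by_contra hn
        have := hc u hua hn
        omega
      have h1 := Finset.card_le_card hsub
      have h2 := Finset.card_image_le (s := I v) (f := f)
      rw [Nat.card_Icc] at h1
      omega
    obtain ⟨u, hua, hun, huf⟩ := hu
    have hne : u ≠ v := hua.ne
    have hvu : v ∈ I u := by
      by_contra hc
      exact hun ((h.or_adj u v hua).2 hc)
    have hvI : #(insert u (I v)) = #(I v) + 1 := Finset.card_insert_of_notMem hun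
    have huI : #((I u).erase v) + 1 = #(I u) := Finset.card_erase_add_one hvu
    let Inew : V → Finset V := fun x =>
      if x = v then insert u (I v) else if x = u then (I u).erase v else I x
    have Inewv : Inew v = insert u (I v) := by simp [Inew]
    have Inewu : Inew u = (I u).erase v := by simp [Inew, hne]
    have Inewx : ∀ x, x ≠ v → x ≠ u → Inew x = I x := by
      intro x h1 h2
      simp [Inew, h1, h2]
    let fnew : V → ℕ := fun x => if x = u ∧ #(I u) = 1 then 0 else f x
    have fnewx : ∀ x, x ≠ u → fnew x = f x := by
      intro x h1
      simp [fnew, h1]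
    have fnewle : ∀ x, fnew x ≤ f x := by
      intro x
      simp only [fnew]
      split_ifs <;> omega
    have nz : #(I u) = 1 → ∀ x, G.Adj u x → f x ≠ 0 := by
      intro h1 x hx
      by_cases hxv : x = v
      · subst hxv; omega
      · have hxu : x ∉ I u := by
          intro hc
          obtain ⟨y, hy⟩ := Finset.card_eq_one.1 h1
          rw [hy, Finset.mem_singleton] at hc hvu
          exact hxv (hc.trans hvu.symm)
        have hm := (h.or_adj u x hx).2 hxu
        have := h.le x
        have := Finset.card_pos.2 ⟨u, hm⟩
        omega
    refine ⟨Inew, fnew, ⟨?_, ?_, ?_, ?_, ?_, ?_⟩, ?_⟩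
    · intro a b hab
      have := h.or_adj a b hab
      have := hab.ne
      simp only [Inew]
      grind
    · intro a b hab
      have := h.adj a b
      have := hua.symm
      simp only [Inew] at hab
      grind
    · intro a b hab
      have := h.proper a b hab
      have := hab.ne
      have := hab.symm
      simp only [fnew]
      grind
    · intro x
      by_cases hxv : x = v
      · subst hxv
        rw [Inewv, fnewx _ hne.symm]
        omega
      · by_cases hxu : x = u
        · subst hxu
          have := h.le x
          rw [Inewu]
          simp only [fnew]
          split_ifs <;> omega
        · rw [Inewx x hxv hxu, fnewx x hxu]
          exact h.le x
    · intro x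
      by_cases hxv : x = v
      · subst hxv
        rw [Inewv]
        omega
      · by_cases hxu : x = u
        · subst hxu
          rw [Inewu]
          intro h0
          have : #(I x) = 1 := by omega
          simp [fnew, this]
        · rw [Inewx x hxv hxu, fnewx x hxu]
          exact h.zero x
    · exact fun x => (fnewle x).trans (h.bd x)
    · unfold potential
      have hmem : u ∈ (Finset.univ : Finset V).erase v := by simp [hne]
      rw [← Finset.add_sum_erase _ _ (mem_univ v), ← Finset.add_sum_erase _ _ hmem,
        ← Finset.add_sum_erase univ (fun x => f x * _) (mem_univ v),
        ← Finset.add_sum_erase _ (fun x => f x * _) hmem]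
      have hrest : ∑ x ∈ (univ.erase v).erase u, fnew x * (Fintype.card V + 1 - #(Inew x))
          = ∑ x ∈ (univ.erase v).erase u, f x * (Fintype.card V + 1 - #(I x)) := by
        apply Finset.sum_congr rfl
        intro x hx
        simp only [Finset.mem_erase] at hx
        rw [Inewx x hx.2.1 hx.1, fnewx x hx.1]
      rw [hrest, Inewv, Inewu, fnewx v hne.symm, hvI]
      have e1 : Fintype.card V + 1 - #(I v) = (Fintype.card V + 1 - (#(I v) + 1)) + 1 := by
        have := hcard v; omega
      have e2 : Fintype.card V + 1 - #((I u).erase v) = (Fintype.card V + 1 - #(I u)) + 1 := by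
        have := hcard u; omega
      rw [e1, e2]
      have := Nat.mul_le_mul_right (Fintype.card V + 1 - #(I u) + 1) (fnewle u)
      simp only [Nat.mul_add, Nat.mul_one] at this ⊢
      omega

lemma ValidPair.exists_good {V : Type*} [Fintype V] {G : SimpleGraph V} {k : ℕ} :
    ∀ (N : ℕ) (I : V → Finset V) (f : V → ℕ), potential I f = N → ValidPair G k I f →
    ∃ Inew fnew, ValidPair G k Inew fnew ∧ ∀ v, fnew v ≤ 2 * #(Inew v) := by
  intro N
  induction N using Nat.strong_induction_on with
  | _ N ih =>
    intro I f hN h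
    by_cases hg : ∀ v, f v ≤ 2 * #(I v)
    · exact ⟨I, f, h, hg⟩
    · push Not at hg
      obtain ⟨v, hv⟩ := hg
      obtain ⟨Inew, fnew, hnew, hlt⟩ := h.improve v hv
      exact ih _ (hN ▸ hlt) Inew fnew rfl hnew

lemma ValidPair.exists_weights {V : Type*} [Fintype V] {G : SimpleGraph V} {k : ℕ}
    {I : V → Finset V} {f : V → ℕ} (h : ValidPair G k I f) :
    ∃ w, IsSemiProperOrientation G w ∧ (∀ v, inWeight w v ≤ k) ∧ ∀ u v, w u v ≤ 2 := by
  classical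
  obtain ⟨I, f, h, hg⟩ := ValidPair.exists_good _ I f rfl h
  have hT : ∀ v, ∃ T, T ⊆ I v ∧ #T = f v - #(I v) := fun v =>
    Finset.exists_subset_card_eq (by have := hg v; omega)
  choose T hTs hTc using hT
  let w : V → V → ℕ := fun u v => (if u ∈ I v then 1 else 0) + (if u ∈ T v then 1 else 0)
  have hw : ∀ v, inWeight w v = f v := by
    intro v
    have := h.le v
    have h1 := hTc v
    simp only [inWeight, w, Finset.sum_add_distrib, Finset.sum_boole, Finset.filter_mem_eq_inter,
      Finset.univ_inter, Nat.cast_id]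
    omega
  refine ⟨w, ⟨?_, ?_, ?_⟩, ?_, ?_⟩
  · intro u v huv
    have h1 := h.or_adj u v huv
    have h2 := @hTs v u
    have h3 := @hTs u v
    simp only [w]
    grind
  · intro u v huv
    have h1 := h.adj u v
    have h2 := @hTs v u
    simp only [w]
    grind
  · intro u v huv
    rw [hw, hw]
    exact h.proper u v huv
  · intro v
    rw [hw]
    exact h.bd v
  · intro u v
    simp only [w]
    split_ifs <;> omega

lemma IsSemiProperOrientation.validPair {V : Type*} [Fintype V] {G : SimpleGraph V} {k : ℕ}
    {w : V → V → ℕ} (h : IsSemiProperOrientation G w) (hk : ∀ v, inWeight w v ≤ k) :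
    ∃ I f, ValidPair G k I f := by
  classical
  obtain ⟨h1, h2, h3⟩ := h
  refine ⟨fun v => univ.filter (fun u => 0 < w u v), inWeight w, ⟨?_, ?_, h3, ?_, ?_, hk⟩⟩
  · intro u v huv
    have := h1 u v huv
    simp only [mem_filter, mem_univ, true_and]
    omega
  · intro u v huv
    simp only [mem_filter, mem_univ, true_and] at huv
    by_contra hc
    have := h2 u v hc
    omega
  · intro v
    rw [Finset.card_filter, inWeight]
    apply Finset.sum_le_sum
    intro u _
    split_ifs <;> omega
  · intro v hv
    rw [Finset.card_eq_zero, Finset.filter_eq_empty_iff] at hv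
    rw [inWeight]
    apply Finset.sum_eq_zero
    intro u hu
    have := hv hu
    omega

lemma exists_validPair {V : Type*} [Fintype V] (G : SimpleGraph V) :
    ∃ k I f, ValidPair G k I f := by
  classical
  let e := Fintype.equivFin V
  let I : V → Finset V := fun v => univ.filter (fun u => G.Adj u v ∧ (e u : ℕ) < e v)
  refine ⟨Fintype.card V + Fintype.card V, I,
    fun v => if #(I v) = 0 then 0 else Fintype.card V + e v, ⟨?_, ?_, ?_, ?_, ?_, ?_⟩⟩
  · intro u v huv
    have : (e u : ℕ) ≠ e v := fun hc => huv.ne (e.injective (Fin.ext hc))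
    simp only [I, mem_filter, mem_univ, true_and, huv, huv.symm]
    omega
  · intro u v huv
    simp only [I, mem_filter] at huv
    exact huv.2.1
  · intro u v huv
    have hne : (e u : ℕ) ≠ e v := fun hc => huv.ne (e.injective (Fin.ext hc))
    have hV : 0 < Fintype.card V := Fintype.card_pos_iff.2 ⟨u⟩
    have key : #(I u) ≠ 0 ∨ #(I v) ≠ 0 := by
      rcases lt_or_gt_of_ne hne with h | h
      · right
        exact Finset.card_ne_zero_of_mem (a := u) (by simp only [I, mem_filter, mem_univ, true_and]; exact ⟨huv, h⟩)
      · left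
        exact Finset.card_ne_zero_of_mem (a := v) (by simp only [I, mem_filter, mem_univ, true_and]; exact ⟨huv.symm, h⟩)
    split_ifs <;> omega
  · intro v
    have := Finset.card_le_univ (I v)
    split_ifs <;> omega
  · intro v hv
    simp [hv]
  · intro v
    have := (e v).isLt
    split_ifs <;> omega

/-- every finite simple graph has an optimal semi-proper orientation in
which every arc has weight `1` or `2` (equivalently, all weights are at most `2`, since
non-arcs get weight `0` and arcs have positive weight). -/
theorem exists_optimal_semiProperOrientation_weights_le_two
    {V : Type*} [Fintype V] (G : SimpleGraph V) :
    ∃ w, IsSemiProperOrientation G w ∧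
      (Finset.univ.sup (inWeight w) = spoNumber G) ∧
      ∀ u v, w u v ≤ 2 := by
  have hne : { k | ∃ w, IsSemiProperOrientation G w ∧ ∀ v, inWeight w v ≤ k }.Nonempty := by
    obtain ⟨k, I, f, h⟩ := exists_validPair G
    obtain ⟨w, hw, hk, -⟩ := h.exists_weights
    exact ⟨k, w, hw, hk⟩
  obtain ⟨w₀, hw₀, hk₀⟩ := Nat.sInf_mem hne
  obtain ⟨I, f, h⟩ := hw₀.validPair hk₀
  obtain ⟨w, hw, hk, h2⟩ := h.exists_weights
  refine ⟨w, hw, le_antisymm (Finset.sup_le fun v _ => hk v) ?_, h2⟩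
  exact Nat.sInf_le ⟨w, hw, fun v => Finset.le_sup (f := inWeight w) (mem_univ v)⟩
end

section
/- Let P = v1 v2 … vn be the path graph on n ≥ 7 vertices. Then there exist three semi-proper orientations of P in which every arc has weight one, each satisfying w⁻(v1) = 0 and w⁻(vn) = 0, and such that: (a) in the first, w⁻(v2) = 2, w⁻(v_{n−2}) = 0 and w⁻(v_{n−1}) = 2; (b) in the second, w⁻(v2) = 1, w⁻(v3) = 2, w⁻(v_{n−3}) = 0, w⁻(v_{n−2}) = 2 and w⁻(v_{n−1}) = 1; (c) in the third, w⁻(v2) = 1, w⁻(v_{n−2}) = 0 and w⁻(v_{n−1}) = 2. -/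
open Finset

/-- The weight-one orientation of the path in which the edge `{i, i+1}` points to `i+1`
iff `r i`. -/
def pathOr (n : ℕ) (r : ℕ → Bool) (u v : Fin n) : ℕ :=
  (if u.1 + 1 = v.1 ∧ r u.1 = true then 1 else 0) +
  (if u.1 = v.1 + 1 ∧ r v.1 = false then 1 else 0)

lemma inWeight_pathOr (n : ℕ) (r : ℕ → Bool) (v : Fin n) :
    inWeight (pathOr n r) v =
      (if 0 < v.1 ∧ r (v.1 - 1) = true then 1 else 0) +
      (if v.1 + 1 < n ∧ r v.1 = false then 1 else 0) := by
  have hv := v.2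
  unfold inWeight pathOr
  rw [Finset.sum_add_distrib]
  congr 1
  · by_cases h : 0 < v.1
    · rw [Finset.sum_eq_single (⟨v.1 - 1, by omega⟩ : Fin n)]
      · have h1 : v.1 - 1 + 1 = v.1 := by omega
        simp [h, h1]
      · intro b _ hb
        rw [if_neg]
        rintro ⟨h1, -⟩
        apply hb
        ext
        simp only
        omega
      · simp
    · rw [if_neg (fun h1 => h h1.1)]
      apply Finset.sum_eq_zero
      intro u _
      rw [if_neg]
      rintro ⟨h1, -⟩
      omega
  · by_cases h : v.1 + 1 < n
    · rw [Finset.sum_eq_single (⟨v.1 + 1, h⟩ : Fin n)]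
      · simp [h]
      · intro b _ hb
        rw [if_neg]
        rintro ⟨h1, -⟩
        exact hb (Fin.ext h1)
      · simp
    · rw [if_neg (fun h1 => h h1.1)]
      apply Finset.sum_eq_zero
      intro u _
      rw [if_neg]
      rintro ⟨h1, -⟩
      omega

lemma pathOr_le (n : ℕ) (r : ℕ → Bool) (u v : Fin n) : pathOr n r u v ≤ 1 := by
  unfold pathOr
  split_ifs <;> omega

lemma pathOr_semiProper (n : ℕ) (r : ℕ → Bool) (hn : 3 ≤ n) (h0 : r 0 = true)
    (hl : r (n - 2) = false)
    (h : ∀ i, i + 3 < n → ¬ (r i = r (i + 1) ∧ r (i + 1) = r (i + 2))) :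
    IsSemiProperOrientation (SimpleGraph.pathGraph n) (pathOr n r) := by
  have key : ∀ u v : Fin n, u.1 + 1 = v.1 →
      inWeight (pathOr n r) u ≠ inWeight (pathOr n r) v := by
    rintro ⟨i, hi⟩ ⟨j, hj⟩ hij
    simp only at hij
    subst hij
    rw [inWeight_pathOr, inWeight_pathOr]
    simp only [Nat.add_sub_cancel]
    rcases i with _ | i
    · cases h1 : r 1 <;> simp [h0] <;> omega
    · by_cases hb : i + 3 < n
      · have := h i hb
        cases h1 : r i <;> cases h2 : r (i + 1) <;> cases h3 : r (i + 2) <;>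
          simp_all <;> omega
      · have e : n - 2 = i + 1 := by omega
        rw [e] at hl
        have e2 : ¬ (i + 1 + 1 + 1 < n) := by omega
        simp [hl, e2, hj]
  refine ⟨?_, ?_, ?_⟩
  · intro u v huv
    rw [SimpleGraph.pathGraph_adj] at huv
    unfold pathOr
    rcases huv with e | e
    · have e1 : ¬ (v.1 + 1 = u.1) := by omega
      have e2 : ¬ (u.1 = v.1 + 1) := by omega
      cases h1 : r u.1 <;> simp [h1, ← e] <;> omega
    · have e1 : ¬ (u.1 + 1 = v.1) := by omega
      have e2 : ¬ (v.1 = u.1 + 1) := by omega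
      cases h1 : r v.1 <;> simp [h1, ← e] <;> omega
  · intro u v huv
    rw [SimpleGraph.pathGraph_adj] at huv
    unfold pathOr
    rw [if_neg (fun h => huv (Or.inl h.1)), if_neg (fun h => huv (Or.inr h.1.symm))]
  · intro u v huv
    rw [SimpleGraph.pathGraph_adj] at huv
    rcases huv with e | e
    · exact key u v e
    · exact (key v u e).symm

/-- for the path `v1 v2 … vn` (`n ≥ 7`, vertex `vi` is `⟨i-1, _⟩ : Fin n`),
there are three semi-proper orientations with all arc weights one such that
`w⁻(v1) = w⁻(vn) = 0` and
(a) `w⁻(v2) = 2`, `w⁻(v_{n-2}) = 0`, `w⁻(v_{n-1}) = 2`;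
(b) `w⁻(v2) = 1`, `w⁻(v3) = 2`, `w⁻(v_{n-3}) = 0`, `w⁻(v_{n-2}) = 2`, `w⁻(v_{n-1}) = 1`;
(c) `w⁻(v2) = 1`, `w⁻(v_{n-2}) = 0`, `w⁻(v_{n-1}) = 2`. -/
theorem pathGraph_three_semiProperOrientations (n : ℕ) (hn : 7 ≤ n) :
    (∃ w, IsSemiProperOrientation (SimpleGraph.pathGraph n) w ∧ (∀ u v, w u v ≤ 1) ∧
      inWeight w ⟨0, by omega⟩ = 0 ∧ inWeight w ⟨n - 1, by omega⟩ = 0 ∧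
      inWeight w ⟨1, by omega⟩ = 2 ∧ inWeight w ⟨n - 3, by omega⟩ = 0 ∧
      inWeight w ⟨n - 2, by omega⟩ = 2) ∧
    (∃ w, IsSemiProperOrientation (SimpleGraph.pathGraph n) w ∧ (∀ u v, w u v ≤ 1) ∧
      inWeight w ⟨0, by omega⟩ = 0 ∧ inWeight w ⟨n - 1, by omega⟩ = 0 ∧
      inWeight w ⟨1, by omega⟩ = 1 ∧ inWeight w ⟨2, by omega⟩ = 2 ∧
      inWeight w ⟨n - 4, by omega⟩ = 0 ∧ inWeight w ⟨n - 3, by omega⟩ = 2 ∧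
      inWeight w ⟨n - 2, by omega⟩ = 1) ∧
    (∃ w, IsSemiProperOrientation (SimpleGraph.pathGraph n) w ∧ (∀ u v, w u v ≤ 1) ∧
      inWeight w ⟨0, by omega⟩ = 0 ∧ inWeight w ⟨n - 1, by omega⟩ = 0 ∧
      inWeight w ⟨1, by omega⟩ = 1 ∧ inWeight w ⟨n - 3, by omega⟩ = 0 ∧
      inWeight w ⟨n - 2, by omega⟩ = 2) := by
  refine ⟨?_, ?_, ?_⟩
  · refine ⟨pathOr n (fun i => decide ((i < 1 ∨ (1 < i ∧ i < 3)) ∨ (3 ≤ i ∧ (i + n) % 2 = 1))),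
      pathOr_semiProper n _ (by omega) (by simp) (by simp; omega) ?_, pathOr_le n _,
      ?_, ?_, ?_, ?_, ?_⟩
    · intro i hi
      simp only [decide_eq_decide]
      omega
    all_goals
      rw [inWeight_pathOr]
      simp only [decide_eq_true_eq, decide_eq_false_iff_not]
      split_ifs <;> omega
  · refine ⟨pathOr n (fun i => decide (i < 2 ∨ (3 ≤ i ∧ (i + n) % 2 = 0 ∧ i + 2 < n))),
      pathOr_semiProper n _ (by omega) (by simp) (by simp; omega) ?_, pathOr_le n _,
      ?_, ?_, ?_, ?_, ?_, ?_, ?_⟩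
    · intro i hi
      simp only [decide_eq_decide]
      omega
    all_goals
      rw [inWeight_pathOr]
      simp only [decide_eq_true_eq, decide_eq_false_iff_not]
      split_ifs <;> omega
  · refine ⟨pathOr n (fun i => decide (i < 2 ∨ (3 ≤ i ∧ (i + n) % 2 = 1))),
      pathOr_semiProper n _ (by omega) (by simp) (by simp; omega) ?_, pathOr_le n _,
      ?_, ?_, ?_, ?_, ?_⟩
    · intro i hi
      simp only [decide_eq_decide]
      omega
    all_goals
      rw [inWeight_pathOr]
      simp only [decide_eq_true_eq, decide_eq_false_iff_not]
      split_ifs <;> omega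
end

section
/- Let G be a finite 2-connected simple graph, let s be a vertex of G, and suppose G admits an adjacent-ear construction from a cycle containing s: there is a sequence of subgraphs G_0 ⊆ G_1 ⊆ ⋯ ⊆ G_k = G such that G_0 is a cycle with s ∈ V(G_0) and, for each 0 ≤ i < k, G_{i+1} is obtained from G_i by adding a path of length at least 2 whose two endpoints are distinct adjacent vertices of G_i and whose internal vertices do not belong to G_i. Then G has a semi-proper orientation (D,w) with w⁻(v) ≤ 4 for every vertex v and w⁻(s) = 0. -/
open Finset

/-- A graph is 2-connected if it has at least 3 vertices and deleting any single vertex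
leaves a connected graph. -/
def TwoConnected {α : Type*} (H : SimpleGraph α) : Prop :=
  3 ≤ Nat.card α ∧ ∀ v : α, (((⊤ : H.Subgraph).deleteVerts {v}).coe).Connected

/-- `B` is obtained from `A` by attaching an ear of length at least `2` whose two
endpoints are distinct adjacent vertices of `A` and whose internal vertices avoid `A`. -/
def AdjEarStep {α : Type*} (H : SimpleGraph α) (A B : H.Subgraph) : Prop :=
  ∃ (a b : α) (P : H.Walk a b), P.IsPath ∧ 2 ≤ P.length ∧ a ≠ b ∧ A.Adj a b ∧
    (∀ x ∈ P.support, x ≠ a → x ≠ b → x ∉ A.verts) ∧ B = A ⊔ P.toSubgraph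

/-- `H` admits an adjacent-ear construction from a cycle through `s`: a nested sequence
of subgraphs starting from a cycle containing `s`, each step adding an ear of length at
least `2` attached to two distinct adjacent vertices, and ending with all of `H`. -/
def HasAdjEarConstruction {α : Type*} (H : SimpleGraph α) (s : α) : Prop :=
  ∃ (k : ℕ) (F : ℕ → H.Subgraph),
    (∃ c : H.Walk s s, c.IsCycle ∧ F 0 = c.toSubgraph) ∧
    (∀ i < k, AdjEarStep H (F i) (F (i + 1))) ∧ F k = ⊤


/-- The induction predicate: `H` has a semi-proper orientation with in-weights at most `4`
and in-weight `0` at `s`. -/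
def GoodOrientation {V : Type*} [Fintype V] (s : V) (H : SimpleGraph V) : Prop :=
  ∃ w, IsSemiProperOrientation H w ∧ (∀ v, inWeight w v ≤ 4) ∧ inWeight w s = 0

theorem good_bot {V : Type*} [Fintype V] (s : V) : GoodOrientation s (⊥ : SimpleGraph V) :=
  ⟨fun _ _ => 0, ⟨by simp, by simp, by simp⟩, by simp [inWeight], by simp [inWeight]⟩

/-- Adding arcs into an isolated vertex `v`, with weights given by `f`. -/
theorem good_extend {V : Type*} [Fintype V] {s : V} {H H' : SimpleGraph V} {w : V → V → ℕ}
    (hw : IsSemiProperOrientation H w) (hw4 : ∀ v, inWeight w v ≤ 4) (hws : inWeight w s = 0)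
    {v : V} (hvs : v ≠ s) (hiso : ∀ x, ¬ H.Adj v x) (f : V → ℕ) (hfv : f v = 0)
    (hf4 : ∑ x, f x ≤ 4) (hne : ∀ x, 0 < f x → inWeight w x ≠ ∑ x, f x)
    (hadj : ∀ x y, H'.Adj x y ↔ H.Adj x y ∨ (y = v ∧ 0 < f x) ∨ (x = v ∧ 0 < f y)) :
    GoodOrientation s H' := by
  classical
  obtain ⟨h1, h2, h3⟩ := hw
  have hiso' : ∀ x, ¬ H.Adj x v := fun x hx => hiso x hx.symm
  have ev : inWeight (fun x y => if y = v then f x else w x y) v = ∑ x, f x := by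
    simp [inWeight]
  have eo : ∀ y, y ≠ v →
      inWeight (fun x y => if y = v then f x else w x y) y = inWeight w y := by
    intro y hy
    simp [inWeight, hy]
  refine ⟨fun x y => if y = v then f x else w x y, ⟨?_, ?_, ?_⟩, ?_, ?_⟩
  · intro x y hxy
    rcases (hadj x y).1 hxy with h | ⟨rfl, h⟩ | ⟨rfl, h⟩
    · have hx : x ≠ v := by rintro rfl; exact hiso _ h
      have hy : y ≠ v := by rintro rfl; exact hiso' _ h
      simpa [hx, hy] using h1 x y h
    · have hx : x ≠ y := by rintro rfl; omega
      left
      simp [hx, h, h2 _ _ (hiso x)]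
    · have hy : y ≠ x := by rintro rfl; omega
      right
      simp [hy, h, h2 _ _ (hiso y)]
  · intro x y hxy
    rw [hadj] at hxy
    push Not at hxy
    by_cases hy : y = v
    · have := hxy.2.1 hy
      simp [hy]; omega
    · simpa [hy] using h2 _ _ hxy.1
  · intro x y hxy
    rcases (hadj x y).1 hxy with h | ⟨rfl, h⟩ | ⟨rfl, h⟩
    · have hx : x ≠ v := by rintro rfl; exact hiso _ h
      have hy : y ≠ v := by rintro rfl; exact hiso' _ h
      rw [eo _ hx, eo _ hy]
      exact h3 _ _ h
    · have hx : x ≠ y := by rintro rfl; omega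
      rw [eo _ hx, ev]
      exact hne _ h
    · have hy : y ≠ x := by rintro rfl; omega
      rw [eo _ hy, ev]
      exact (hne _ h).symm
  · intro y
    by_cases hy : y = v
    · rw [hy, ev]; exact hf4
    · rw [eo _ hy]; exact hw4 y
  · rw [eo _ hvs.symm]; exact hws

theorem good_one {V : Type*} [Fintype V] {s : V} {H H' : SimpleGraph V}
    (hg : GoodOrientation s H) {v a : V} (hvs : v ≠ s) (hiso : ∀ x, ¬ H.Adj v x)
    (hva : v ≠ a)
    (hadj : ∀ x y, H'.Adj x y ↔ H.Adj x y ∨ (y = v ∧ x = a) ∨ (x = v ∧ y = a)) :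
    GoodOrientation s H' := by
  classical
  obtain ⟨w, hw, hw4, hws⟩ := hg
  obtain ⟨t, ht0, ht4, hta⟩ : ∃ t, 0 < t ∧ t ≤ 4 ∧ inWeight w a ≠ t := by
    by_cases h : inWeight w a = 1
    · exact ⟨2, by omega, by omega, by omega⟩
    · exact ⟨1, by omega, by omega, h⟩
  have hf : ∀ x, 0 < (if x = a then t else 0) ↔ x = a := by
    intro x; split_ifs with h <;> simp [h, ht0]
  refine good_extend hw hw4 hws hvs hiso (fun x => if x = a then t else 0) ?_ ?_ ?_ ?_
  · simp [hva]
  · simpa using ht4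
  · intro x hx
    rw [(hf x).1 hx]
    simpa using hta
  · intro x y
    rw [hadj]
    simp only [hf]

theorem good_two {V : Type*} [Fintype V] {s : V} {H H' : SimpleGraph V}
    (hg : GoodOrientation s H) {v a b : V} (hvs : v ≠ s) (hiso : ∀ x, ¬ H.Adj v x)
    (hva : v ≠ a) (hvb : v ≠ b) (hab : a ≠ b)
    (hadj : ∀ x y, H'.Adj x y ↔ H.Adj x y ∨ (y = v ∧ (x = a ∨ x = b)) ∨
      (x = v ∧ (y = a ∨ y = b))) :
    GoodOrientation s H' := by
  classical
  obtain ⟨w, hw, hw4, hws⟩ := hg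
  obtain ⟨t, ht0, ht4, hta, htb⟩ :
      ∃ t, 0 < t ∧ t ≤ 3 ∧ inWeight w a ≠ 1 + t ∧ inWeight w b ≠ 1 + t := by
    by_cases h : inWeight w a ≠ 2 ∧ inWeight w b ≠ 2
    · exact ⟨1, by omega, by omega, by omega, by omega⟩
    by_cases h : inWeight w a ≠ 3 ∧ inWeight w b ≠ 3
    · exact ⟨2, by omega, by omega, by omega, by omega⟩
    · exact ⟨3, by omega, by omega, by omega, by omega⟩
  have hf : ∀ x, 0 < ((if x = a then 1 else 0) + (if x = b then t else 0)) ↔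
      x = a ∨ x = b := by
    intro x; split_ifs <;> simp_all
  have hsum : ∑ x, ((if x = a then 1 else 0) + (if x = b then t else 0)) = 1 + t := by
    simp [Finset.sum_add_distrib]
  refine good_extend hw hw4 hws hvs hiso
    (fun x => (if x = a then 1 else 0) + (if x = b then t else 0)) ?_ ?_ ?_ ?_
  · simp [hva, hvb]
  · rw [hsum]; omega
  · intro x hx
    rw [hsum]
    rcases (hf x).1 hx with rfl | rfl
    · exact hta
    · exact htb
  · intro x y
    rw [hadj]
    simp only [hf]

/-- Adding an ear. -/
theorem good_ear {V : Type*} [Fintype V] {G : SimpleGraph V} {s : V} {a b : V}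
    (P : G.Walk a b) : ∀ {H H' : SimpleGraph V}, GoodOrientation s H → P.IsPath →
    2 ≤ P.length →
    (∀ x ∈ P.support, x ≠ a → x ≠ b → x ≠ s ∧ ∀ y, ¬ H.Adj x y) →
    (∀ x y, H'.Adj x y ↔ H.Adj x y ∨ P.toSubgraph.Adj x y) →
    GoodOrientation s H' := by
  induction P with
  | nil => intro H H' _ _ h; simp at h
  | @cons a c b h Q ih =>
    intro H H' hg hP hl hint hadj
    rw [SimpleGraph.Walk.cons_isPath_iff] at hP
    have hac : a ≠ c := h.ne
    have hcb : c ≠ b := by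
      rintro rfl
      have := (SimpleGraph.Walk.isPath_iff_nil).1 hP.1
      rw [SimpleGraph.Walk.nil_iff_length_eq] at this
      simp [this] at hl
    obtain ⟨hcs, hciso⟩ := hint c (by simp) hac.symm hcb
    by_cases hQ : 2 ≤ Q.length
    · have hg' : GoodOrientation s (H ⊔ SimpleGraph.edge c a) := by
        refine good_one (v := c) (a := a) hg hcs hciso hac.symm ?_
        intro x y
        simp only [SimpleGraph.sup_adj, SimpleGraph.edge_adj]
        grind
      refine ih hg' hP.1 hQ ?_ ?_
      · intro x hx hxc hxb
        have hxa : x ≠ a := by rintro rfl; exact hP.2 hx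
        obtain ⟨h1, h2⟩ := hint x (by simp [hx]) hxa hxb
        refine ⟨h1, fun y => ?_⟩
        simp only [SimpleGraph.sup_adj, SimpleGraph.edge_adj]
        have := h2 y
        grind
      · intro x y
        rw [hadj]
        simp only [SimpleGraph.sup_adj, SimpleGraph.edge_adj, SimpleGraph.Walk.toSubgraph,
          SimpleGraph.Subgraph.sup_adj, SimpleGraph.subgraphOfAdj_adj, Sym2.eq_iff]
        grind
    · cases Q with
      | nil => simp at hcb
      | @cons _ d _ h' R =>
        cases R with
        | cons _ _ => simp at hQ
        | nil =>
          have hab : a ≠ b := by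
            rintro rfl; simp at hP
          refine good_two (v := c) (a := a) (b := b) hg hcs hciso hac.symm hcb hab ?_
          intro x y
          rw [hadj]
          simp only [SimpleGraph.Walk.toSubgraph,
            SimpleGraph.Subgraph.sup_adj, SimpleGraph.subgraphOfAdj_adj, Sym2.eq_iff,
            SimpleGraph.singletonSubgraph_adj]
          simp
          grind

/-- The starting cycle. -/
theorem good_cycle {V : Type*} [Fintype V] {G : SimpleGraph V} {s : V}
    (c : G.Walk s s) (hc : c.IsCycle) : GoodOrientation s c.toSubgraph.spanningCoe := by
  have hl := hc.three_le_length
  cases c with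
  | nil => simp at hl
  | @cons _ x _ h p =>
    rw [SimpleGraph.Walk.cons_isCycle_iff] at hc
    have hg : GoodOrientation s (SimpleGraph.edge x s) := by
      refine good_one (v := x) (a := s) (good_bot s) h.ne.symm (by simp) h.ne.symm ?_
      intro y z
      simp only [SimpleGraph.edge_adj, SimpleGraph.bot_adj]
      have := h.ne
      grind
    refine good_ear p hg hc.1 (by simp at hl; omega) ?_ ?_
    · intro y _ hyx hys
      refine ⟨hys, fun z => ?_⟩
      simp only [SimpleGraph.edge_adj]
      grind
    · intro y z
      have := h.ne
      simp only [SimpleGraph.Subgraph.spanningCoe_adj, SimpleGraph.edge_adj,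
        SimpleGraph.Walk.toSubgraph,
        SimpleGraph.Subgraph.sup_adj, SimpleGraph.subgraphOfAdj_adj, Sym2.eq_iff]
      grind

/-- if `G` is a finite 2-connected simple graph admitting an adjacent-ear
construction from a cycle containing the vertex `s`, then `G` has a semi-proper
orientation with all in-weights at most `4` and `w⁻(s) = 0`. -/
theorem twoConnected_adjEar_semiProperOrientation
    {V : Type*} [Fintype V] (G : SimpleGraph V) (s : V)
    (h2 : TwoConnected G) (hear : HasAdjEarConstruction G s) :
    ∃ w, IsSemiProperOrientation G w ∧ (∀ v, inWeight w v ≤ 4) ∧ inWeight w s = 0 := by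
  obtain ⟨k, F, ⟨c, hc, hF0⟩, hstep, hFk⟩ := hear
  have key : ∀ i ≤ k, s ∈ (F i).verts ∧ GoodOrientation s (F i).spanningCoe := by
    intro i
    induction i with
    | zero =>
      intro _
      rw [hF0]
      exact ⟨by simp, good_cycle c hc⟩
    | succ i ih =>
      intro hi
      obtain ⟨hs, hg⟩ := ih (by omega)
      obtain ⟨a, b, P, hP, hl, -, -, hint, hB⟩ := hstep i (by omega)
      rw [hB]
      refine ⟨Or.inl hs, good_ear P hg hP hl ?_ ?_⟩
      · intro x hx hxa hxb
        have hxA := hint x hx hxa hxb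
        refine ⟨fun e => hxA (e ▸ hs), fun y hy => hxA ?_⟩
        exact (F i).edge_vert hy
      · intro x y
        simp
  have := (key k le_rfl).2
  rw [hFk] at this
  simpa [GoodOrientation] using this
end

section
/- Let G be a finite connected simple graph each of whose blocks (maximal subgraphs with no cut vertex) B is either a single edge or is 2-connected and has the property that for every vertex s of B there is an adjacent-ear construction of B from a cycle containing s, i.e., a sequence of subgraphs B_0 ⊆ B_1 ⊆ ⋯ ⊆ B_m = B where B_0 is a cycle with s ∈ V(B_0) and each B_{i+1} is obtained from B_i by adding a path of length at least 2 whose two endpoints are distinct adjacent vertices of B_i and whose internal vertices do not belong to B_i. Then χ⃗_s(G) ≤ 4; that is, G has a semi-proper orientation (D,w) with w⁻(v) ≤ 4 for every vertex v. (In particular, every outerplanar graph satisfies these hypotheses, so every outerplanar graph G satisfies χ⃗_s(G) ≤ 4.) -/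
open Finset

/-- A subgraph `B` of `G` is nonseparable: it is connected and has no cut vertex, i.e.
deleting any of its vertices that leaves at least one vertex leaves it connected. -/
def NoCutVertex {V : Type*} {G : SimpleGraph V} (B : G.Subgraph) : Prop :=
  B.coe.Connected ∧ ∀ v ∈ B.verts,
    (B.deleteVerts {v}).verts.Nonempty → ((B.deleteVerts {v}).coe).Connected

/-- A block of `G`: a maximal subgraph with no cut vertex. -/
def IsBlock {V : Type*} {G : SimpleGraph V} (B : G.Subgraph) : Prop :=
  NoCutVertex B ∧ ∀ B' : G.Subgraph, NoCutVertex B' → B ≤ B' → B = B'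

lemma conn_of_root {V : Type*} {G : SimpleGraph V} (B : G.Subgraph) (r : V) (hr : r ∈ B.verts)
    (h : ∀ X : Set V, X ⊆ B.verts → X.Nonempty → r ∉ X →
      (∀ x ∈ X, ∀ y ∈ B.verts, B.Adj x y → y ∈ X) → False) : B.coe.Connected := by
  rw [SimpleGraph.connected_iff_exists_forall_reachable]
  refine ⟨⟨r, hr⟩, ?_⟩
  by_contra hc
  push Not at hc
  obtain ⟨y, hy⟩ := hc
  refine h {y | ∃ hy : y ∈ B.verts, ¬ B.coe.Reachable ⟨r, hr⟩ ⟨y, hy⟩} ?_ ?_ ?_ ?_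
  · rintro x ⟨hx, _⟩
    exact hx
  · exact ⟨y.1, y.2, hy⟩
  · rintro ⟨_, h2⟩
    exact h2 (SimpleGraph.Reachable.refl _)
  · rintro x ⟨hx, h2⟩ y hy hxy
    refine ⟨hy, fun h3 => h2 (h3.trans ?_)⟩
    apply SimpleGraph.Adj.reachable
    simpa using hxy.symm

lemma exists_block {V : Type*} [Fintype V] {G : SimpleGraph V} (B : G.Subgraph)
    (hB : NoCutVertex B) : ∃ B' : G.Subgraph, IsBlock B' ∧ B ≤ B' := by
  obtain ⟨B', h1, h2⟩ := (Set.toFinite {B : G.Subgraph | NoCutVertex B}).exists_le_maximal hB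
  exact ⟨B', ⟨h2.prop, fun B'' h3 h4 => le_antisymm h4 (h2.le_of_ge h3 h4)⟩, h1⟩

lemma ear_degenerate {α : Type*} [Finite α] (H : SimpleGraph α) (s : α)
    (h : HasAdjEarConstruction H s) (T : Set α) (hT : ∃ x ∈ T, x ≠ s) :
    ∃ v ∈ T, v ≠ s ∧ {u | u ∈ T ∧ H.Adj v u}.ncard ≤ 2 := by
  obtain ⟨k, F, ⟨c, hc, h0⟩, hstep, hk⟩ := h
  have key : ∀ i ≤ k, s ∈ (F i).verts ∧ ∀ T : Set α, T ⊆ (F i).verts → (∃ x ∈ T, x ≠ s) →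
      ∃ v ∈ T, v ≠ s ∧ {u | u ∈ T ∧ (F i).Adj v u}.ncard ≤ 2 := by
    intro i
    induction i with
    | zero =>
      intro _
      rw [h0]
      refine ⟨by simp, ?_⟩
      rintro T hT ⟨x, hx, hxs⟩
      refine ⟨x, hx, hxs, ?_⟩
      have hxc : x ∈ c.support := by simpa using hT hx
      rw [← hc.ncard_neighborSet_toSubgraph_eq_two hxc]
      exact Set.ncard_le_ncard (fun u hu => hu.2)
    | succ i ih =>
      intro hi
      obtain ⟨hs, ih⟩ := ih (by omega)
      obtain ⟨a, b, P, hP, hlen, hab, hadj, hint, hB⟩ := hstep i (by omega)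
      rw [hB]
      refine ⟨by simp [hs], ?_⟩
      intro T hT hx
      by_cases hTi : T ⊆ (F i).verts
      · obtain ⟨v, hv, hvs, hle⟩ := ih T hTi hx
        refine ⟨v, hv, hvs, le_trans (Set.ncard_le_ncard ?_) hle⟩
        rintro u ⟨hu, huv⟩
        refine ⟨hu, ?_⟩
        rcases huv with huv | huv
        · exact huv
        · have hvP : v ∈ P.support := by simpa using huv.fst_mem
          have huP : u ∈ P.support := by simpa using huv.snd_mem
          have h1 : v = a ∨ v = b := by
            by_contra hn
            push Not at hn
            exact hint v hvP hn.1 hn.2 (hTi hv)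
          have h2 : u = a ∨ u = b := by
            by_contra hn
            push Not at hn
            exact hint u huP hn.1 hn.2 (hTi hu)
          have hne := huv.ne
          rcases h1 with rfl | rfl <;> rcases h2 with rfl | rfl
          · exact absurd rfl hne
          · exact hadj
          · exact hadj.symm
          · exact absurd rfl hne
      · obtain ⟨v, hv, hvA⟩ := Set.not_subset.1 hTi
        have hvP : v ∈ P.support := by
          have := hT hv
          simpa [hvA] using this
        have hva : v ≠ a := fun h => hvA (h ▸ hadj.fst_mem)
        have hvb : v ≠ b := fun h => hvA (h ▸ hadj.snd_mem)
        refine ⟨v, hv, fun h => hvA (h ▸ hs), ?_⟩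
        have hd : (P.toSubgraph.neighborSet v).ncard ≤ 2 := by
          obtain ⟨n, hn, hnl⟩ := SimpleGraph.Walk.mem_support_iff_exists_getVert.1 hvP
          have hn0 : n ≠ 0 := by
            rintro rfl
            exact hva (by simpa using hn.symm)
          have hn1 : n < P.length := by
            rcases lt_or_eq_of_le hnl with h | h
            · exact h
            · subst h
              exact absurd (by simpa using hn.symm) hvb
          rw [← hn, hP.ncard_neighborSet_toSubgraph_internal_eq_two hn0 hn1]
        refine le_trans (Set.ncard_le_ncard ?_) hd
        rintro u ⟨_, huv | huv⟩
        · exact absurd huv.fst_mem hvA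
        · exact huv
  have := (key k le_rfl).2 T (by simp [hk]) hT
  simpa [hk] using this

open Classical in
lemma graph_degenerate {V : Type*} [Fintype V] (G : SimpleGraph V)
    (hblocks : ∀ B : G.Subgraph, IsBlock B →
      (∃ (a b : V) (h : G.Adj a b), B = G.subgraphOfAdj h) ∨
      (TwoConnected B.coe ∧ ∀ s : B.verts, HasAdjEarConstruction B.coe s))
    (S : Finset V) (hS : S.Nonempty) : ∃ v ∈ S, (S.filter (G.Adj v)).card ≤ 2 := by
  by_contra hcon
  push Not at hcon
  let Good : V → Finset V → Prop := fun s C => s ∈ S ∧ C ⊆ S ∧ s ∉ C ∧ C.Nonempty ∧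
    ∀ x ∈ C, ∀ y ∈ S, G.Adj x y → y ∈ C ∨ y = s
  have hex : ∃ p : V × Finset V, Good p.1 p.2 := by
    obtain ⟨s, hs⟩ := hS
    refine ⟨(s, S.erase s), hs, S.erase_subset s, by simp, ?_, ?_⟩
    · have h3 := hcon s hs
      obtain ⟨y, hy⟩ := Finset.card_pos.1 (by omega : 0 < (S.filter (G.Adj s)).card)
      rw [Finset.mem_filter] at hy
      exact ⟨y, Finset.mem_erase.2 ⟨hy.2.ne', hy.1⟩⟩
    · intro x hx y hy _
      by_cases h : y = s <;> simp [h, hy]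
  obtain ⟨⟨s, C⟩, hgood, hmin⟩ := Set.exists_min_image {p : V × Finset V | Good p.1 p.2}
    (fun p => p.2.card) (Set.toFinite _) hex
  obtain ⟨hs, hCS, hsC, hCne, hcl⟩ := hgood
  have hmin' : ∀ s' C', Good s' C' → C.card ≤ C'.card := fun s' C' h => hmin (s', C') h
  set T : Set V := insert s (C : Set V) with hTdef
  have hTS : ∀ x ∈ T, x ∈ S := by
    rintro x (rfl | hx)
    · exact hs
    · exact hCS hx
  have hclT : ∀ x ∈ C, ∀ y ∈ S, G.Adj x y → y ∈ T := by
    intro x hx y hy hxy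
    rcases hcl x hx y hy hxy with h | h
    · exact Or.inr h
    · exact Or.inl h
  have hno : NoCutVertex ((⊤ : G.Subgraph).induce T) := by
    refine ⟨?_, ?_⟩
    · refine conn_of_root _ s (Or.inl rfl) ?_
      intro X hX hXne hsX hXcl
      have hXC : ∀ x ∈ X, x ∈ C := by
        intro x hx
        rcases hX hx with h | h
        · exact absurd (h ▸ hx) hsX
        · exact h
      obtain ⟨x, hx⟩ := hXne
      have hxS : x ∈ S := hCS (hXC x hx)
      have hXcl' : ∀ x ∈ X, ∀ y ∈ S, G.Adj x y → y ∈ X := by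
        intro x hx y hy hxy
        have hyT := hclT x (hXC x hx) y hy hxy
        exact hXcl x hx y hyT (by simpa using ⟨hX hx, hyT, hxy⟩)
      have hg : Good x (X.toFinset.erase x) := by
        refine ⟨hxS, ?_, by simp, ?_, ?_⟩
        · intro y hy
          simp at hy
          exact hCS (hXC y hy.2)
        · have h3 := hcon x hxS
          obtain ⟨y, hy⟩ := Finset.card_pos.1 (by omega : 0 < (S.filter (G.Adj x)).card)
          rw [Finset.mem_filter] at hy
          exact ⟨y, by simpa using ⟨hy.2.ne', hXcl' x hx y hy.1 hy.2⟩⟩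
        · intro z hz y hy hzy
          simp at hz
          by_cases h : y = x
          · exact Or.inr h
          · left
            simpa using ⟨h, hXcl' z hz.2 y hy hzy⟩
      have h1 := hmin' _ _ hg
      have h2 : (X.toFinset.erase x) ⊂ C := by
        refine Finset.ssubset_iff_of_subset ?_ |>.2 ⟨x, hXC x hx, by simp⟩
        intro y hy
        simp at hy
        exact hXC y hy.2
      have := Finset.card_lt_card h2
      omega
    · intro v hv _
      have hv' : v ∈ T := hv
      by_cases hvs : v = s
      · subst hvs
        obtain ⟨c, hc⟩ := hCne
        have hcv : c ≠ v := fun h => hsC (h ▸ hc)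
        refine conn_of_root _ c ⟨Or.inr hc, by simpa using hcv⟩ ?_
        intro X hX hXne hcX hXcl
        have hXC : ∀ x ∈ X, x ∈ C := by
          intro x hx
          rcases (hX hx).1 with h | h
          · exact absurd h (hX hx).2
          · exact h
        have hg : Good v X.toFinset := by
          refine ⟨hs, ?_, ?_, by simpa using hXne, ?_⟩
          · intro y hy
            simp at hy
            exact hCS (hXC y hy)
          · simp
            exact fun h => hsC (hXC v h)
          · intro x hx y hy hxy
            simp at hx
            rcases hcl x (hXC x hx) y hy hxy with h | h
            · left
              have hyv : y ≠ v := fun h' => hsC (h' ▸ h)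
              have hxv : x ≠ v := fun h' => hsC (h' ▸ hXC x hx)
              have : y ∈ X := by
                refine hXcl x hx y ⟨Or.inr h, by simpa using hyv⟩ ?_
                rw [SimpleGraph.Subgraph.deleteVerts_adj]
                exact ⟨(hX hx).1, (hX hx).2, Or.inr h, by simpa using hyv,
                  (hX hx).1, Or.inr h, hxy⟩
              simpa using this
            · exact Or.inr h
        have h1 := hmin' _ _ hg
        have h2 : X.toFinset ⊂ C := by
          refine Finset.ssubset_iff_of_subset ?_ |>.2 ⟨c, hc, by simpa using hcX⟩
          intro y hy
          simp at hy
          exact hXC y hy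
        have := Finset.card_lt_card h2
        omega
      · have hvC : v ∈ C := by
          rcases hv' with h | h
          · exact absurd h hvs
          · exact h
        refine conn_of_root _ s ⟨Or.inl rfl, by simpa using Ne.symm hvs⟩ ?_
        intro X hX hXne hsX hXcl
        have hXC : ∀ x ∈ X, x ∈ C := by
          intro x hx
          rcases (hX hx).1 with h | h
          · exact absurd (h ▸ hx) hsX
          · exact h
        have hvX : v ∉ X := fun h => (hX h).2 rfl
        have hg : Good v X.toFinset := by
          refine ⟨hCS hvC, ?_, by simpa using hvX, by simpa using hXne, ?_⟩
          · intro y hy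
            simp at hy
            exact hCS (hXC y hy)
          · intro x hx y hy hxy
            simp at hx
            by_cases hyv : y = v
            · exact Or.inr hyv
            · left
              have hyT := hclT x (hXC x hx) y hy hxy
              have : y ∈ X := by
                refine hXcl x hx y ⟨hyT, by simpa using hyv⟩ ?_
                rw [SimpleGraph.Subgraph.deleteVerts_adj]
                exact ⟨(hX hx).1, (hX hx).2, hyT, by simpa using hyv,
                  (hX hx).1, hyT, hxy⟩
              simpa using this
        have h1 := hmin' _ _ hg
        have h2 : X.toFinset ⊂ C := by
          refine Finset.ssubset_iff_of_subset ?_ |>.2 ⟨v, hvC, by simpa using hvX⟩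
          intro y hy
          simp at hy
          exact hXC y hy
        have := Finset.card_lt_card h2
        omega
  obtain ⟨B, hB, hle⟩ := exists_block _ hno
  have hTB : T ⊆ B.verts := hle.1
  have hadjB : ∀ x ∈ T, ∀ y ∈ T, G.Adj x y → B.Adj x y :=
    fun x hx y hy hxy => hle.2 ⟨hx, hy, hxy⟩
  rcases hblocks B hB with ⟨a, b, hab, rfl⟩ | ⟨_, hear⟩
  · obtain ⟨c, hc⟩ := hCne
    have h3 := hcon c (hCS hc)
    have : S.filter (G.Adj c) ⊆ {a, b} := by
      intro y hy
      rw [Finset.mem_filter] at hy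
      have := hTB (hclT c hc y hy.1 hy.2)
      simpa using this
    have h4 := (Finset.card_le_card this).trans Finset.card_le_two
    omega
  · have hsB : s ∈ B.verts := hTB (Or.inl rfl)
    obtain ⟨c, hc⟩ := hCne
    obtain ⟨v, hvT, hvs, hcard⟩ := ear_degenerate B.coe ⟨s, hsB⟩ (hear ⟨s, hsB⟩)
      {x | x.1 ∈ T} ⟨⟨c, hTB (Or.inr hc)⟩, Or.inr hc, fun h => hsC (by
        have := congrArg Subtype.val h
        simp at this
        exact this ▸ hc)⟩
    have hvC : v.1 ∈ C := by
      rcases hvT with h | h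
      · exact absurd (Subtype.ext h) hvs
      · exact h
    have h3 := hcon v.1 (hCS hvC)
    have hsub : ((S.filter (G.Adj v.1) : Finset V) : Set V) ⊆
        Subtype.val '' {u : B.verts | u ∈ {x : B.verts | x.1 ∈ T} ∧ B.coe.Adj v u} := by
      intro y hy
      rw [Finset.mem_coe, Finset.mem_filter] at hy
      have hyT := hclT v.1 hvC y hy.1 hy.2
      exact ⟨⟨y, hTB hyT⟩, ⟨hyT, hadjB _ hvT _ hyT hy.2⟩, rfl⟩
    have h4 := Set.ncard_le_ncard hsub
    have h5 := Set.ncard_image_le (f := Subtype.val)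
      (s := {u : B.verts | u ∈ {x : B.verts | x.1 ∈ T} ∧ B.coe.Adj v u})
    rw [Set.ncard_coe_finset] at h4
    omega

open Classical in
lemma choose_weights {V : Type*} [Fintype V] (c : V → ℕ) (N : Finset V) (hN : N.card ≤ 2) :
    ∃ f : V → ℕ, (∀ u, 0 < f u ↔ u ∈ N) ∧ ∑ u, f u ≤ 4 ∧ ∀ u ∈ N, c u ≠ ∑ u, f u := by
  have h012 : N.card = 0 ∨ N.card = 1 ∨ N.card = 2 := by omega
  rcases h012 with h | h | h
  · rw [Finset.card_eq_zero] at h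
    subst h
    exact ⟨fun _ => 0, by simp, by simp, by simp⟩
  · obtain ⟨a, rfl⟩ := Finset.card_eq_one.1 h
    obtain ⟨t, ht0, ht4, hta⟩ : ∃ t, 0 < t ∧ t ≤ 4 ∧ c a ≠ t := by
      by_cases h : c a = 1
      · exact ⟨2, by omega, by omega, by omega⟩
      · exact ⟨1, by omega, by omega, h⟩
    have hsum : ∑ u, (if u = a then t else 0) = t := by simp
    refine ⟨fun u => if u = a then t else 0, ?_, by rw [hsum]; exact ht4, ?_⟩
    · intro u
      by_cases hu : u = a <;> simp [hu, ht0]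
    · intro u hu
      rw [hsum]
      rw [Finset.mem_singleton] at hu
      rw [hu]
      exact hta
  · obtain ⟨a, b, hab, rfl⟩ := Finset.card_eq_two.1 h
    obtain ⟨t, ht0, ht4, hta, htb⟩ : ∃ t, 0 < t ∧ t + 1 ≤ 4 ∧ c a ≠ t + 1 ∧ c b ≠ t + 1 := by
      by_cases h1 : c a ≠ 2 ∧ c b ≠ 2
      · exact ⟨1, by omega, by omega, by omega, by omega⟩
      · by_cases h2 : c a ≠ 3 ∧ c b ≠ 3
        · exact ⟨2, by omega, by omega, by omega, by omega⟩
        · exact ⟨3, by omega, by omega, by omega, by omega⟩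
    have hsum : ∑ u, ((if u = a then t else 0) + (if u = b then 1 else 0)) = t + 1 := by
      simp [Finset.sum_add_distrib]
    refine ⟨fun u => (if u = a then t else 0) + (if u = b then 1 else 0), ?_,
      by rw [hsum]; exact ht4, ?_⟩
    · intro u
      by_cases hu : u = a <;> by_cases hu' : u = b <;> simp [hu, hu', ht0]
    · intro u hu
      rw [hsum]
      rw [Finset.mem_insert, Finset.mem_singleton] at hu
      rcases hu with rfl | rfl
      · exact hta
      · exact htb

open Classical in
lemma orient_of_degenerate {V : Type*} [Fintype V] (G : SimpleGraph V)
    (hdeg : ∀ S : Finset V, S.Nonempty → ∃ v ∈ S, (S.filter (G.Adj v)).card ≤ 2)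
    (S : Finset V) : ∃ w : V → V → ℕ,
      (∀ u ∈ S, ∀ v ∈ S, G.Adj u v → (0 < w u v ∧ w v u = 0) ∨ (0 < w v u ∧ w u v = 0)) ∧
      (∀ u v, ¬ (u ∈ S ∧ v ∈ S ∧ G.Adj u v) → w u v = 0) ∧
      (∀ u ∈ S, ∀ v ∈ S, G.Adj u v → inWeight w u ≠ inWeight w v) ∧
      ∀ v, inWeight w v ≤ 4 := by
  induction S using Finset.strongInduction with
  | H S ih =>
  rcases S.eq_empty_or_nonempty with rfl | hS
  · exact ⟨fun _ _ => 0, by simp, by simp, by simp, by simp [inWeight]⟩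
  obtain ⟨v, hv, hcard⟩ := hdeg S hS
  obtain ⟨w, h1, h2, h3, h4⟩ := ih (S.erase v) (Finset.erase_ssubset hv)
  obtain ⟨f, hf1, hf2, hf3⟩ := choose_weights (inWeight w) _ hcard
  have hfN : ∀ u, 0 < f u ↔ u ∈ S ∧ G.Adj v u := by simpa using hf1
  have hinv : inWeight (fun u x => if x = v then f u else w u x) v = ∑ u, f u := by
    simp [inWeight]
  have hin : ∀ x, x ≠ v → inWeight (fun u x => if x = v then f u else w u x) x = inWeight w x := by
    intro x hx
    simp [inWeight, hx]
  have hwv : ∀ x, w v x = 0 := fun x => h2 v x (by simp)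
  refine ⟨fun u x => if x = v then f u else w u x, ?_, ?_, ?_, ?_⟩
  · intro x hx y hy hxy
    by_cases hxv : x = v
    · subst hxv
      have : y ≠ x := hxy.ne'
      right
      simp [this, hwv, (hfN y).2 ⟨hy, hxy⟩]
    · by_cases hyv : y = v
      · subst hyv
        left
        simp [hxv, hwv, (hfN x).2 ⟨hx, hxy.symm⟩]
      · simpa [hxv, hyv] using h1 x (by simp [hxv, hx]) y (by simp [hyv, hy]) hxy
  · intro x y hxy
    by_cases hyv : y = v
    · subst hyv
      have : ¬ 0 < f x := by
        rw [hfN]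
        rintro ⟨ha, hb⟩
        exact hxy ⟨ha, hv, hb.symm⟩
      simpa using this
    · simp only [hyv, if_false]
      apply h2
      rintro ⟨ha, hb, hc⟩
      exact hxy ⟨(Finset.mem_erase.1 ha).2, (Finset.mem_erase.1 hb).2, hc⟩
  · intro x hx y hy hxy
    by_cases hxv : x = v
    · subst hxv
      rw [hinv, hin y hxy.ne']
      exact (hf3 y (by simp [hy, hxy])).symm
    · by_cases hyv : y = v
      · subst hyv
        rw [hinv, hin x hxv]
        exact hf3 x (by simp [hx, hxy.symm])
      · rw [hin x hxv, hin y hyv]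
        exact h3 x (by simp [hxv, hx]) y (by simp [hyv, hy]) hxy
  · intro x
    by_cases hxv : x = v
    · subst hxv
      rw [hinv]
      exact hf2
    · rw [hin x hxv]
      exact h4 x

/-- let `G` be a finite connected simple graph each of whose blocks is
either a single edge, or is 2-connected and admits, for every vertex `s` of the block,
an adjacent-ear construction from a cycle containing `s`.  Then `χ⃗ₛ(G) ≤ 4`, i.e. `G`
has a semi-proper orientation with all in-weights at most `4`.  (In particular this
applies to every outerplanar graph.) -/
theorem blocks_adjEar_semiProperOrientationNumber_le_four
    {V : Type*} [Fintype V] (G : SimpleGraph V)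
    (hconn : G.Connected)
    (hblocks : ∀ B : G.Subgraph, IsBlock B →
      (∃ (a b : V) (h : G.Adj a b), B = G.subgraphOfAdj h) ∨
      (TwoConnected B.coe ∧ ∀ s : B.verts, HasAdjEarConstruction B.coe s)) :
    spoNumber G ≤ 4 ∧
      ∃ w, IsSemiProperOrientation G w ∧ ∀ v, inWeight w v ≤ 4 := by
  obtain ⟨w, h1, h2, h3, h4⟩ :=
    orient_of_degenerate G (graph_degenerate G hblocks) Finset.univ
  have hw : IsSemiProperOrientation G w :=
    ⟨fun u v h => h1 u (Finset.mem_univ u) v (Finset.mem_univ v) h,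
      fun u v h => h2 u v (fun h' => h h'.2.2),
      fun u v h => h3 u (Finset.mem_univ u) v (Finset.mem_univ v) h⟩
  exact ⟨Nat.sInf_le ⟨w, hw, h4⟩, w, hw, h4⟩
end

section
/- Let UOP(4) be the universal outerplanar graph of depth 4, defined recursively as follows: UOP(1) is a triangle, all three of whose edges are called outeredges; for k ≥ 1, UOP(k+1) is obtained from UOP(k) by adding, for each outeredge {x,y} of UOP(k), a new vertex adjacent to both x and y, the 2·(number of outeredges of UOP(k)) newly created edges being the outeredges of UOP(k+1). (UOP(4) has 24 vertices and 45 edges.) Then UOP(4) has no semi-proper orientation (D,w) with w⁻(v) ≤ 3 for every vertex v, and in fact χ⃗_s(UOP(4)) = 4. -/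
open Finset

/-- The universal outerplanar graph `UOP(4)`: start with the triangle on `{0,1,2}`
(level 1) and, at each of three further levels, add for every outeredge `{x,y}` of the
previous level a new vertex adjacent to both `x` and `y`; the new edges are the
outeredges of the new level.  It has `24` vertices and `45` edges. -/
def UOP4 : SimpleGraph (Fin 24) := SimpleGraph.fromEdgeSet
  { s(0, 1), s(0, 2), s(1, 2),
    s(0, 3), s(1, 3), s(0, 4), s(2, 4), s(1, 5), s(2, 5),
    s(0, 6), s(3, 6), s(1, 7), s(3, 7), s(0, 8), s(4, 8), s(2, 9), s(4, 9),
    s(1, 10), s(5, 10), s(2, 11), s(5, 11),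
    s(0, 12), s(6, 12), s(3, 13), s(6, 13), s(1, 14), s(7, 14), s(3, 15), s(7, 15),
    s(0, 16), s(8, 16), s(4, 17), s(8, 17), s(2, 18), s(9, 18), s(4, 19), s(9, 19),
    s(1, 20), s(10, 20), s(5, 21), s(10, 21), s(2, 22), s(11, 22), s(5, 23), s(11, 23) }

/-- Bookkeeping for an outeredge of level 3. -/
theorem level_one (a b c p pz q qz : ℕ) (hac : a ≠ c) (hbc : b ≠ c)
    (hab : a ≠ b) (ha : a ≤ 3) (hb : b ≤ 3) (hc : c ≤ 3) (hp : 1 ≤ p + pz) (hq : 1 ≤ q + qz)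
    (hin : pz + qz ≤ c) (h : 5 ≤ a + b) : 1 ≤ p + q := by
  omega

/-- Bookkeeping for an outeredge of level 2. -/
theorem level_two (a b c p pz q qz s r sz rz : ℕ) (hac : a ≠ c) (hbc : b ≠ c)
    (hab : a ≠ b) (ha : a ≤ 3) (hb : b ≤ 3) (hc : c ≤ 3) (hp : 1 ≤ p + pz) (hq : 1 ≤ q + qz)
    (hin : pz + qz + r + rz ≤ c) (h1 : 5 ≤ a + c → 1 ≤ s + r) (h2 : 5 ≤ b + c → 1 ≤ sz + rz)
    (h : a = 3 ∨ b = 3) : 1 ≤ p + q + s + sz := by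
  omega

/-- Bookkeeping for an outeredge of level 1. -/
theorem level_three (a b c p pz q qz s r sz rz : ℕ) (hac : a ≠ c) (hbc : b ≠ c)
    (hab : a ≠ b) (ha : a ≤ 3) (hb : b ≤ 3) (hc : c ≤ 3) (hp : 1 ≤ p + pz) (hq : 1 ≤ q + qz)
    (hin : pz + qz + r + rz ≤ c) (h1 : a = 3 ∨ c = 3 → 1 ≤ s + r)
    (h2 : b = 3 ∨ c = 3 → 1 ≤ sz + rz) :
    (2 ≤ a ∨ 2 ≤ b → 1 ≤ p + q + s + sz) ∧ (5 ≤ a + b → 2 ≤ p + q + s + sz) := by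
  omega

/-- The edges of `UOP4` as a list. -/
def UOP4edges : List (Fin 24 × Fin 24) :=
  [(0, 1), (0, 2), (1, 2), (0, 3), (1, 3), (0, 4), (2, 4), (1, 5), (2, 5), (0, 6), (3, 6), (1, 7),
    (3, 7), (0, 8), (4, 8), (2, 9), (4, 9), (1, 10), (5, 10), (2, 11), (5, 11), (0, 12), (6, 12),
    (3, 13), (6, 13), (1, 14), (7, 14), (3, 15), (7, 15), (0, 16), (8, 16), (4, 17), (8, 17), (2,
    18), (9, 18), (4, 19), (9, 19), (1, 20), (10, 20), (5, 21), (10, 21), (2, 22), (11, 22), (5,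
    23), (11, 23)]

theorem forall_edges (p : Fin 24 × Fin 24 → Prop) [DecidablePred p]
    (h : (UOP4edges.all fun e => decide (p e)) = true) : ∀ e ∈ UOP4edges, p e :=
  fun e he => of_decide_eq_true (List.all_eq_true.1 h e he)

theorem UOP4_adj_iff (u v : Fin 24) : UOP4.Adj u v ↔
    s(u, v) ∈ UOP4edges.map (fun e => s(e.1, e.2)) ∧ u ≠ v := by
  simp only [UOP4, SimpleGraph.fromEdgeSet_adj, Set.mem_insert_iff, Set.mem_singleton_iff,
    UOP4edges, List.map_cons, List.map_nil, List.mem_cons, List.not_mem_nil, or_false]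

theorem UOP4_adj_of (u v : Fin 24) (h : (u, v) ∈ UOP4edges) : UOP4.Adj u v := by
  have key : ∀ e ∈ UOP4edges, e.1 ≠ e.2 := forall_edges _ (by decide +kernel)
  exact (UOP4_adj_iff u v).2 ⟨List.mem_map.2 ⟨(u, v), h, rfl⟩, key _ h⟩

theorem mem_of_UOP4_adj (u v : Fin 24) (h : UOP4.Adj u v) :
    (u, v) ∈ UOP4edges ∨ (v, u) ∈ UOP4edges := by
  obtain ⟨e, he, heq⟩ := List.mem_map.1 ((UOP4_adj_iff u v).1 h).1
  rcases Sym2.eq_iff.1 heq with ⟨h1, h2⟩ | ⟨h1, h2⟩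
  · left
    rw [← h1, ← h2]
    exact he
  · right
    rw [← h1, ← h2]
    exact he

theorem sum_le_inWeight (w : Fin 24 → Fin 24 → ℕ) (l : List (Fin 24)) (hl : l.Nodup)
    (v : Fin 24) : (l.map fun u => w u v).sum ≤ inWeight w v := by
  rw [← List.sum_toFinset _ hl]
  exact Finset.sum_le_univ_sum_of_nonneg fun _ => Nat.zero_le _

theorem UOP4_no_three : ¬ ∃ w, IsSemiProperOrientation UOP4 w ∧ ∀ v, inWeight w v ≤ 3 := by
  rintro ⟨w, ⟨h1, -, h3⟩, hle⟩
  have ne : ∀ u v, (u, v) ∈ UOP4edges → inWeight w u ≠ inWeight w v :=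
    fun u v h => h3 u v (UOP4_adj_of u v h)
  have pos : ∀ u v, (u, v) ∈ UOP4edges → 1 ≤ w v u + w u v := by
    intro u v h
    rcases h1 u v (UOP4_adj_of u v h) with h | h <;> omega
  have C0 := sum_le_inWeight w [1, 2, 3, 4, 6, 8, 12, 16] (by decide) 0
  have C1 := sum_le_inWeight w [0, 2, 3, 5, 7, 10, 14, 20] (by decide) 1
  have C2 := sum_le_inWeight w [0, 1, 4, 5, 9, 11, 18, 22] (by decide) 2
  have C3 := sum_le_inWeight w [0, 1, 6, 7, 13, 15] (by decide) 3
  have C4 := sum_le_inWeight w [0, 2, 8, 9, 17, 19] (by decide) 4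
  have C5 := sum_le_inWeight w [1, 2, 10, 11, 21, 23] (by decide) 5
  have C6 := sum_le_inWeight w [0, 3, 12, 13] (by decide) 6
  have C7 := sum_le_inWeight w [1, 3, 14, 15] (by decide) 7
  have C8 := sum_le_inWeight w [0, 4, 16, 17] (by decide) 8
  have C9 := sum_le_inWeight w [2, 4, 18, 19] (by decide) 9
  have C10 := sum_le_inWeight w [1, 5, 20, 21] (by decide) 10
  have C11 := sum_le_inWeight w [2, 5, 22, 23] (by decide) 11
  have C12 := sum_le_inWeight w [0, 6] (by decide) 12
  have C13 := sum_le_inWeight w [3, 6] (by decide) 13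
  have C14 := sum_le_inWeight w [1, 7] (by decide) 14
  have C15 := sum_le_inWeight w [3, 7] (by decide) 15
  have C16 := sum_le_inWeight w [0, 8] (by decide) 16
  have C17 := sum_le_inWeight w [4, 8] (by decide) 17
  have C18 := sum_le_inWeight w [2, 9] (by decide) 18
  have C19 := sum_le_inWeight w [4, 9] (by decide) 19
  have C20 := sum_le_inWeight w [1, 10] (by decide) 20
  have C21 := sum_le_inWeight w [5, 10] (by decide) 21
  have C22 := sum_le_inWeight w [2, 11] (by decide) 22
  have C23 := sum_le_inWeight w [5, 11] (by decide) 23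
  simp only [List.map_cons, List.map_nil, List.sum_cons, List.sum_nil, add_zero] at *
  have G23 := level_one (inWeight w 5) (inWeight w 11) (inWeight w 23) (w 23 5) (w 5 23) (w 23 11)
    (w 11 23)
    (ne 5 23 (by decide)) (ne 11 23 (by decide))
    ((ne 5 11 (by decide))) (hle 5) (hle 11) (hle 23) (pos 5 23 (by decide)) (pos 11 23 (by
      decide)) (by omega)
  have G22 := level_one (inWeight w 2) (inWeight w 11) (inWeight w 22) (w 22 2) (w 2 22) (w 22 11)
    (w 11 22)
    (ne 2 22 (by decide)) (ne 11 22 (by decide))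
    ((ne 2 11 (by decide))) (hle 2) (hle 11) (hle 22) (pos 2 22 (by decide)) (pos 11 22 (by
      decide)) (by omega)
  have G21 := level_one (inWeight w 5) (inWeight w 10) (inWeight w 21) (w 21 5) (w 5 21) (w 21 10)
    (w 10 21)
    (ne 5 21 (by decide)) (ne 10 21 (by decide))
    ((ne 5 10 (by decide))) (hle 5) (hle 10) (hle 21) (pos 5 21 (by decide)) (pos 10 21 (by
      decide)) (by omega)
  have G20 := level_one (inWeight w 1) (inWeight w 10) (inWeight w 20) (w 20 1) (w 1 20) (w 20 10)
    (w 10 20)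
    (ne 1 20 (by decide)) (ne 10 20 (by decide))
    ((ne 1 10 (by decide))) (hle 1) (hle 10) (hle 20) (pos 1 20 (by decide)) (pos 10 20 (by
      decide)) (by omega)
  have G19 := level_one (inWeight w 4) (inWeight w 9) (inWeight w 19) (w 19 4) (w 4 19) (w 19 9)
    (w 9 19)
    (ne 4 19 (by decide)) (ne 9 19 (by decide))
    ((ne 4 9 (by decide))) (hle 4) (hle 9) (hle 19) (pos 4 19 (by decide)) (pos 9 19 (by decide))
      (by omega)
  have G18 := level_one (inWeight w 2) (inWeight w 9) (inWeight w 18) (w 18 2) (w 2 18) (w 18 9)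
    (w 9 18)
    (ne 2 18 (by decide)) (ne 9 18 (by decide))
    ((ne 2 9 (by decide))) (hle 2) (hle 9) (hle 18) (pos 2 18 (by decide)) (pos 9 18 (by decide))
      (by omega)
  have G17 := level_one (inWeight w 4) (inWeight w 8) (inWeight w 17) (w 17 4) (w 4 17) (w 17 8)
    (w 8 17)
    (ne 4 17 (by decide)) (ne 8 17 (by decide))
    ((ne 4 8 (by decide))) (hle 4) (hle 8) (hle 17) (pos 4 17 (by decide)) (pos 8 17 (by decide))
      (by omega)
  have G16 := level_one (inWeight w 0) (inWeight w 8) (inWeight w 16) (w 16 0) (w 0 16) (w 16 8)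
    (w 8 16)
    (ne 0 16 (by decide)) (ne 8 16 (by decide))
    ((ne 0 8 (by decide))) (hle 0) (hle 8) (hle 16) (pos 0 16 (by decide)) (pos 8 16 (by decide))
      (by omega)
  have G15 := level_one (inWeight w 3) (inWeight w 7) (inWeight w 15) (w 15 3) (w 3 15) (w 15 7)
    (w 7 15)
    (ne 3 15 (by decide)) (ne 7 15 (by decide))
    ((ne 3 7 (by decide))) (hle 3) (hle 7) (hle 15) (pos 3 15 (by decide)) (pos 7 15 (by decide))
      (by omega)
  have G14 := level_one (inWeight w 1) (inWeight w 7) (inWeight w 14) (w 14 1) (w 1 14) (w 14 7)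
    (w 7 14)
    (ne 1 14 (by decide)) (ne 7 14 (by decide))
    ((ne 1 7 (by decide))) (hle 1) (hle 7) (hle 14) (pos 1 14 (by decide)) (pos 7 14 (by decide))
      (by omega)
  have G13 := level_one (inWeight w 3) (inWeight w 6) (inWeight w 13) (w 13 3) (w 3 13) (w 13 6)
    (w 6 13)
    (ne 3 13 (by decide)) (ne 6 13 (by decide))
    ((ne 3 6 (by decide))) (hle 3) (hle 6) (hle 13) (pos 3 13 (by decide)) (pos 6 13 (by decide))
      (by omega)
  have G12 := level_one (inWeight w 0) (inWeight w 6) (inWeight w 12) (w 12 0) (w 0 12) (w 12 6)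
    (w 6 12)
    (ne 0 12 (by decide)) (ne 6 12 (by decide))
    ((ne 0 6 (by decide))) (hle 0) (hle 6) (hle 12) (pos 0 12 (by decide)) (pos 6 12 (by decide))
      (by omega)
  have G11 := level_two (inWeight w 2) (inWeight w 5) (inWeight w 11) (w 11 2) (w 2 11) (w 11 5)
    (w 5 11)
    (w 22 2) (w 22 11) (w 23 5) (w 23 11)
    (ne 2 11 (by decide)) (ne 5 11 (by decide))
    ((ne 2 5 (by decide))) (hle 2) (hle 5) (hle 11) (pos 2 11 (by decide)) (pos 5 11 (by decide))
      (by omega)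
    (fun h => by have := G22 (by omega); omega) (fun h => by have := G23 (by omega); omega)
  have G10 := level_two (inWeight w 1) (inWeight w 5) (inWeight w 10) (w 10 1) (w 1 10) (w 10 5)
    (w 5 10)
    (w 20 1) (w 20 10) (w 21 5) (w 21 10)
    (ne 1 10 (by decide)) (ne 5 10 (by decide))
    ((ne 1 5 (by decide))) (hle 1) (hle 5) (hle 10) (pos 1 10 (by decide)) (pos 5 10 (by decide))
      (by omega)
    (fun h => by have := G20 (by omega); omega) (fun h => by have := G21 (by omega); omega)
  have G9 := level_two (inWeight w 2) (inWeight w 4) (inWeight w 9) (w 9 2) (w 2 9) (w 9 4) (w 4 9)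
    (w 18 2) (w 18 9) (w 19 4) (w 19 9)
    (ne 2 9 (by decide)) (ne 4 9 (by decide))
    ((ne 2 4 (by decide))) (hle 2) (hle 4) (hle 9) (pos 2 9 (by decide)) (pos 4 9 (by decide)) (by
      omega)
    (fun h => by have := G18 (by omega); omega) (fun h => by have := G19 (by omega); omega)
  have G8 := level_two (inWeight w 0) (inWeight w 4) (inWeight w 8) (w 8 0) (w 0 8) (w 8 4) (w 4 8)
    (w 16 0) (w 16 8) (w 17 4) (w 17 8)
    (ne 0 8 (by decide)) (ne 4 8 (by decide))
    ((ne 0 4 (by decide))) (hle 0) (hle 4) (hle 8) (pos 0 8 (by decide)) (pos 4 8 (by decide)) (by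
      omega)
    (fun h => by have := G16 (by omega); omega) (fun h => by have := G17 (by omega); omega)
  have G7 := level_two (inWeight w 1) (inWeight w 3) (inWeight w 7) (w 7 1) (w 1 7) (w 7 3) (w 3 7)
    (w 14 1) (w 14 7) (w 15 3) (w 15 7)
    (ne 1 7 (by decide)) (ne 3 7 (by decide))
    ((ne 1 3 (by decide))) (hle 1) (hle 3) (hle 7) (pos 1 7 (by decide)) (pos 3 7 (by decide)) (by
      omega)
    (fun h => by have := G14 (by omega); omega) (fun h => by have := G15 (by omega); omega)
  have G6 := level_two (inWeight w 0) (inWeight w 3) (inWeight w 6) (w 6 0) (w 0 6) (w 6 3) (w 3 6)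
    (w 12 0) (w 12 6) (w 13 3) (w 13 6)
    (ne 0 6 (by decide)) (ne 3 6 (by decide))
    ((ne 0 3 (by decide))) (hle 0) (hle 3) (hle 6) (pos 0 6 (by decide)) (pos 3 6 (by decide)) (by
      omega)
    (fun h => by have := G12 (by omega); omega) (fun h => by have := G13 (by omega); omega)
  have G5 := level_three (inWeight w 1) (inWeight w 2) (inWeight w 5) (w 5 1) (w 1 5) (w 5 2) (w 2
    5)
    (w 10 1 + w 20 1) (w 10 5 + w 21 5) (w 11 2 + w 22 2) (w 11 5 + w 23 5)
    (ne 1 5 (by decide)) (ne 2 5 (by decide))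
    ((ne 1 2 (by decide))) (hle 1) (hle 2) (hle 5) (pos 1 5 (by decide)) (pos 2 5 (by decide)) (by
      omega)
    (fun h => by have := G10 (by omega); omega) (fun h => by have := G11 (by omega); omega)
  have G4 := level_three (inWeight w 0) (inWeight w 2) (inWeight w 4) (w 4 0) (w 0 4) (w 4 2) (w 2
    4)
    (w 8 0 + w 16 0) (w 8 4 + w 17 4) (w 9 2 + w 18 2) (w 9 4 + w 19 4)
    (ne 0 4 (by decide)) (ne 2 4 (by decide))
    ((ne 0 2 (by decide))) (hle 0) (hle 2) (hle 4) (pos 0 4 (by decide)) (pos 2 4 (by decide)) (by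
      omega)
    (fun h => by have := G8 (by omega); omega) (fun h => by have := G9 (by omega); omega)
  have G3 := level_three (inWeight w 0) (inWeight w 1) (inWeight w 3) (w 3 0) (w 0 3) (w 3 1) (w 1
    3)
    (w 6 0 + w 12 0) (w 6 3 + w 13 3) (w 7 1 + w 14 1) (w 7 3 + w 15 3)
    (ne 0 3 (by decide)) (ne 1 3 (by decide))
    ((ne 0 1 (by decide))) (hle 0) (hle 1) (hle 3) (pos 0 3 (by decide)) (pos 1 3 (by decide)) (by
      omega)
    (fun h => by have := G6 (by omega); omega) (fun h => by have := G7 (by omega); omega)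
  clear h1 h3
  clear G6 G7 G8 G9 G10 G11 G12 G13 G14 G15 G16 G17 G18 G19 G20 G21 G22 G23
  clear C3 C4 C5 C6 C7 C8 C9 C10 C11 C12 C13 C14 C15 C16 C17 C18 C19 C20 C21 C22 C23
  have n01 := ne 0 1 (by decide)
  have p01 := pos 0 1 (by decide)
  have n02 := ne 0 2 (by decide)
  have p02 := pos 0 2 (by decide)
  have n12 := ne 1 2 (by decide)
  have p12 := pos 1 2 (by decide)
  have b0 := hle 0
  have b1 := hle 1
  have b2 := hle 2
  clear ne pos hle
  omega

/-- First in-neighbour in a semi-proper orientation of `UOP4` with in-weights at most 4. -/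
def UOP4srcFirst : Fin 24 → Fin 24 := fun v =>
  [2, 0, 1, 0, 0, 1, 0, 1, 0, 2, 1, 2, 0, 3, 1, 3, 0, 4, 2, 4, 1, 5, 2, 5].getD v.val 0

/-- Weight of the arc from the first in-neighbour. -/
def UOP4wtFirst : Fin 24 → ℕ := fun v =>
  [2, 3, 4, 1, 1, 1, 1, 1, 1, 1, 1, 1, 1, 1, 1, 1, 1, 1, 1, 1, 1, 1, 1, 1].getD v.val 0

/-- Second in-neighbour in a semi-proper orientation of `UOP4` with in-weights at most 4. -/
def UOP4srcSecond : Fin 24 → Fin 24 := fun v =>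
  [2, 0, 1, 1, 2, 2, 3, 3, 4, 4, 5, 5, 6, 6, 7, 7, 8, 8, 9, 9, 10, 10, 11, 11].getD v.val 0

/-- Weight of the arc from the second in-neighbour. -/
def UOP4wtSecond : Fin 24 → ℕ := fun v =>
  [0, 0, 0, 3, 2, 1, 2, 1, 3, 1, 3, 2, 3, 1, 3, 2, 2, 1, 2, 3, 1, 2, 1, 3].getD v.val 0

/-- A semi-proper orientation of `UOP4` with in-weights at most 4. -/
def UOP4weight (u v : Fin 24) : ℕ :=
  (if u = UOP4srcFirst v then UOP4wtFirst v else 0) +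
    (if u = UOP4srcSecond v then UOP4wtSecond v else 0)

/-- The in-weights of `UOP4weight`. -/
def UOP4color (v : Fin 24) : ℕ := UOP4wtFirst v + UOP4wtSecond v

theorem UOP4_inWeight (v : Fin 24) : inWeight UOP4weight v = UOP4color v := by
  simp only [inWeight, UOP4weight, UOP4color, Finset.sum_add_distrib, Finset.sum_ite_eq',
    Finset.mem_univ, if_true]

theorem UOP4_four : IsSemiProperOrientation UOP4 UOP4weight ∧
    ∀ v, inWeight UOP4weight v ≤ 4 := by
  refine ⟨⟨?_, ?_, ?_⟩, ?_⟩
  · intro u v h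
    have key : ∀ e ∈ UOP4edges,
        (0 < UOP4weight e.1 e.2 ∧ UOP4weight e.2 e.1 = 0) ∨
        (0 < UOP4weight e.2 e.1 ∧ UOP4weight e.1 e.2 = 0) :=
      forall_edges _ (by decide +kernel)
    rcases mem_of_UOP4_adj u v h with h | h
    · exact key _ h
    · exact (key _ h).symm
  · intro u v h
    have key : ∀ v, ((UOP4srcFirst v, v) ∈ UOP4edges ∨ (v, UOP4srcFirst v) ∈ UOP4edges) ∧
        ((UOP4srcSecond v, v) ∈ UOP4edges ∨ (v, UOP4srcSecond v) ∈ UOP4edges) := by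
      decide +kernel
    have adj : ∀ u v, ((u, v) ∈ UOP4edges ∨ (v, u) ∈ UOP4edges) → UOP4.Adj u v := by
      rintro u v (hk | hk)
      · exact UOP4_adj_of _ _ hk
      · exact (UOP4_adj_of _ _ hk).symm
    have hf : u ≠ UOP4srcFirst v := by
      rintro rfl
      exact h (adj _ _ (key v).1)
    have hs : u ≠ UOP4srcSecond v := by
      rintro rfl
      exact h (adj _ _ (key v).2)
    simp only [UOP4weight, if_neg hf, if_neg hs]
  · intro u v h
    have key : ∀ e ∈ UOP4edges, UOP4color e.1 ≠ UOP4color e.2 :=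
      forall_edges _ (by decide +kernel)
    rw [UOP4_inWeight, UOP4_inWeight]
    rcases mem_of_UOP4_adj u v h with h | h
    · exact key _ h
    · exact (key _ h).symm
  · intro v
    rw [UOP4_inWeight]
    revert v
    decide +kernel

/-- `UOP(4)` has no semi-proper orientation with all in-weights at most
`3`, and its semi-proper orientation number equals `4`. -/
theorem UOP4_semiProperOrientationNumber_eq_four :
    (¬ ∃ w, IsSemiProperOrientation UOP4 w ∧ ∀ v, inWeight w v ≤ 3) ∧
      spoNumber UOP4 = 4 := by
  refine ⟨UOP4_no_three, ?_⟩
  unfold spoNumber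
  apply le_antisymm
  · exact Nat.sInf_le (show 4 ∈ {k | ∃ w, IsSemiProperOrientation UOP4 w ∧
        ∀ v, inWeight w v ≤ k} from ⟨UOP4weight, UOP4_four⟩)
  · refine le_csInf ⟨4, UOP4weight, UOP4_four⟩ ?_
    rintro k ⟨w, hw, hk⟩
    by_contra hlt
    exact UOP4_no_three ⟨w, hw, fun v => (hk v).trans (by omega)⟩
end

section
/- For every finite simple graph G, χ⃗_s(G) ≤ Δ(G), where Δ(G) is the maximum vertex degree of G; indeed, G admits a semi-proper orientation (D,w) in which every arc has weight one and w⁻(v) ≤ Δ(G) for every vertex v. -/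
open Finset

open Classical in
theorem spo_aux {V : Type*} [Fintype V] (G : SimpleGraph V) (n : ℕ) :
    ∀ S : Finset V, S.card = n → ∃ w : V → V → ℕ,
      (∀ a b, w a b ≤ if (a ∈ S ∧ b ∈ S) ∧ G.Adj a b then 1 else 0) ∧
      (∀ a b, a ∈ S → b ∈ S → G.Adj a b →
        (0 < w a b ∧ w b a = 0) ∨ (0 < w b a ∧ w a b = 0)) ∧
      (∀ a b, a ∈ S → b ∈ S → G.Adj a b → inWeight w a ≠ inWeight w b) := by
  induction n with
  | zero =>
    intro S hS
    rw [Finset.card_eq_zero] at hS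
    subst hS
    exact ⟨fun _ _ => 0, by simp, by simp, by simp⟩
  | succ n ih =>
    intro S hS
    have hne : S.Nonempty := by
      rw [← Finset.card_pos]; omega
    obtain ⟨v, hv, hmax⟩ := S.exists_max_image
      (fun x => (S.filter (fun u => G.Adj u x)).card) hne
    obtain ⟨w, h1, h2, h3⟩ := ih (S.erase v) (by rw [Finset.card_erase_of_mem hv]; omega)
    let w' : V → V → ℕ := fun a b =>
      if b = v then (if a ∈ S ∧ G.Adj a v then 1 else 0) else w a b
    have hwv : ∀ b, w v b = 0 := by
      intro b
      have := h1 v b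
      simpa using this
    have hin : ∀ u, u ≠ v → inWeight w' u = inWeight w u := by
      intro u hu
      simp [inWeight, w', hu]
    have hinv : inWeight w' v = (S.filter (fun u => G.Adj u v)).card := by
      simp only [inWeight, w', if_true]
      rw [← Finset.card_filter]
      congr 1
      ext x
      simp
    have hlt : ∀ u, u ∈ S → G.Adj u v → inWeight w' u < inWeight w' v := by
      intro u hu huv
      rw [hin u huv.ne, hinv]
      refine lt_of_lt_of_le ?_ (hmax u hu)
      have hle : inWeight w u ≤ ((S.erase v).filter (fun a => G.Adj a u)).card := by
        calc inWeight w u ≤ ∑ a, (if a ∈ S.erase v ∧ G.Adj a u then 1 else 0) := by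
              apply Finset.sum_le_sum
              intro a _
              refine (h1 a u).trans ?_
              split_ifs with p q <;> simp_all
          _ = _ := by
              rw [← Finset.card_filter]
              congr 1
              ext x
              simp
      refine lt_of_le_of_lt hle (Finset.card_lt_card ?_)
      rw [Finset.ssubset_iff_of_subset (Finset.filter_subset_filter _ (Finset.erase_subset _ _))]
      exact ⟨v, by simp [hv, huv.symm], by simp⟩
    refine ⟨w', ?_, ?_, ?_⟩
    · intro a b
      by_cases hb : b = v
      · subst hb
        simp [w', hv]
      · simp only [w', hb, if_false]
        refine (h1 a b).trans ?_
        split_ifs with p q <;> simp_all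
    · intro a b ha hb hab
      by_cases hbv : b = v
      · subst hbv
        left
        simp [w', ha, hab, hab.ne, hwv]
      · by_cases hav : a = v
        · subst hav
          right
          simp [w', hb, hab.symm, hbv, hwv]
        · simpa [w', hbv, hav] using
            h2 a b (by simp [hav, ha]) (by simp [hbv, hb]) hab
    · intro a b ha hb hab
      by_cases hbv : b = v
      · subst hbv
        exact (hlt a ha hab).ne
      · by_cases hav : a = v
        · subst hav
          exact (hlt b hb hab.symm).ne'
        · rw [hin a hav, hin b hbv]
          exact h3 a b (by simp [hav, ha]) (by simp [hbv, hb]) hab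

/-- `χ⃗ₛ(G) ≤ Δ(G)`; indeed `G` has a semi-proper orientation in which
every arc has weight one and all in-weights are at most the maximum degree of `G`. -/
theorem semiProperOrientationNumber_le_maxDegree
    {V : Type*} [Fintype V] (G : SimpleGraph V) [DecidableRel G.Adj] :
    spoNumber G ≤ G.maxDegree ∧
      ∃ w, IsSemiProperOrientation G w ∧ (∀ u v, w u v ≤ 1) ∧
        ∀ v, inWeight w v ≤ G.maxDegree := by
  suffices h : ∃ w, IsSemiProperOrientation G w ∧ (∀ u v, w u v ≤ 1) ∧
        ∀ v, inWeight w v ≤ G.maxDegree by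
    refine ⟨?_, h⟩
    obtain ⟨w, hw, _, hd⟩ := h
    exact Nat.sInf_le ⟨w, hw, hd⟩
  obtain ⟨w, h1, h2, h3⟩ := spo_aux G _ Finset.univ rfl
  have h1' : ∀ a b, w a b ≤ if G.Adj a b then 1 else 0 := by
    intro a b
    have := h1 a b
    by_cases h : G.Adj a b <;> simpa [h] using this
  refine ⟨w, ⟨fun u v => h2 u v (mem_univ _) (mem_univ _), ?_,
    fun u v => h3 u v (mem_univ _) (mem_univ _)⟩, ?_, ?_⟩
  · intro u v h
    simpa [h] using h1' u v
  · intro u v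
    refine (h1' u v).trans ?_
    split_ifs <;> simp
  · intro v
    refine le_trans ?_ (G.degree_le_maxDegree v)
    refine (Finset.sum_le_sum (fun a _ => h1' a v)).trans ?_
    rw [← Finset.card_filter, ← SimpleGraph.card_neighborFinset_eq_degree]
    apply Finset.card_le_card
    intro x hx
    simpa [G.adj_comm] using hx
end

section
/- For every finite tree T (a finite connected acyclic simple graph), χ⃗_s(T) ≤ 2; that is, T admits a semi-proper orientation (D,w) with w⁻(v) ≤ 2 for every vertex v. -/
open Finset

/-- In a tree, every vertex other than the root has exactly one neighbour closer to the root. -/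
lemma tree_unique_parent {V : Type*} (G : SimpleGraph V) (hG : G.IsTree) (r v : V)
    (hv : G.dist r v ≠ 0) : ∃ p, ∀ u, (G.Adj u v ∧ G.dist r v = G.dist r u + 1) ↔ u = p := by
  obtain ⟨q, hq, hl⟩ := hG.connected.exists_path_of_dist r v
  have hnil : ¬ q.Nil := by
    intro h
    rw [← SimpleGraph.Walk.length_eq_zero_iff] at h
    omega
  refine ⟨q.penultimate, fun u => ⟨?_, ?_⟩⟩
  · rintro ⟨hadj, hd⟩
    obtain ⟨s, hs, hsl⟩ := hG.connected.exists_path_of_dist r u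
    have hp : (s.concat hadj).IsPath := by
      apply SimpleGraph.Walk.isPath_of_length_eq_dist
      rw [SimpleGraph.Walk.length_concat]
      omega
    have := (hG.existsUnique_path r v).unique hp hq
    rw [← this]
    simp
  · rintro rfl
    have hadj := q.adj_penultimate hnil
    refine ⟨hadj, ?_⟩
    have h1 : G.dist r q.penultimate ≤ q.dropLast.length := SimpleGraph.dist_le _
    have h2 : q.dropLast.length ≤ q.length := by simp [SimpleGraph.Walk.dropLast]
    rcases hG.dist_eq_dist_add_one_of_adj r hadj with h | h <;> omega

/-- every finite tree `T` satisfies `χ⃗ₛ(T) ≤ 2`, i.e. `T` admits a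
semi-proper orientation with all in-weights at most `2`. -/
theorem tree_semiProperOrientationNumber_le_two
    {V : Type*} [Fintype V] (G : SimpleGraph V) (hG : G.IsTree) :
    spoNumber G ≤ 2 ∧
      ∃ w, IsSemiProperOrientation G w ∧ ∀ v, inWeight w v ≤ 2 := by
  classical
  suffices h : ∃ w, IsSemiProperOrientation G w ∧ ∀ v, inWeight w v ≤ 2 from
    ⟨Nat.sInf_le h, h⟩
  obtain ⟨r⟩ := hG.connected.nonempty
  let w : V → V → ℕ := fun u v =>
    if G.Adj u v ∧ G.dist r v = G.dist r u + 1 then 2 - G.dist r v % 2 else 0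
  have hin : ∀ v, inWeight w v = if G.dist r v = 0 then 0 else 2 - G.dist r v % 2 := by
    intro v
    unfold inWeight
    split_ifs with hv
    · apply Finset.sum_eq_zero
      intro u _
      simp [w, hv]
    · obtain ⟨p, hp⟩ := tree_unique_parent G hG r v hv
      simp [w, hp]
  refine ⟨w, ⟨?_, ?_, ?_⟩, ?_⟩
  · intro u v h
    have h' := h.symm
    simp only [w, h, h', true_and]
    rcases hG.dist_eq_dist_add_one_of_adj r h with h | h
    · right; constructor
      · rw [if_pos h]; omega
      · rw [if_neg]; omega
    · left; constructor
      · rw [if_pos h]; omega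
      · rw [if_neg]; omega
  · intro u v h
    simp [w, h]
  · intro u v h
    rw [hin, hin]
    rcases hG.dist_eq_dist_add_one_of_adj r h with h | h <;> split_ifs <;> omega
  · intro v
    rw [hin]
    split_ifs <;> omega
end
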